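/- Let M and N be nonzero finitely generated R-modules over a local ring R, with M G-perfect. If T̂or_i^R(M,N) = 0 for all i ≥ 0 (this holds, for example, when pd_R(M) < ∞ or id_R(N) < ∞), then sup{ i ≥ 0 : Tor_i^R(M,N) ≠ 0 } + inf{ i ≥ 0 : Ext^i_R(M,N) ≠ 0 } = G-dim_R(M). -/

import Mathlib

open CategoryTheory CategoryTheory.Limits CategoryTheory.MonoidalCategory Opposite

noncomputable section

universe u

variable (R : Type u) [CommRing R]

/-- Ordinary `Ext` of `R`-modules, via the derived functor `Ext` of Mathlib. -/
abbrev ExtMod (n : ℕ) (M N : ModuleCat.{u} R) : ModuleCat.{u} R :=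
  ((Ext R (ModuleCat.{u} R) n).obj (op M)).obj N

/-- Ordinary `Tor` of `R`-modules, via the derived functor `Tor` of Mathlib. -/
abbrev TorMod (n : ℕ) (M N : ModuleCat.{u} R) : ModuleCat.{u} R :=
  ((Tor (ModuleCat.{u} R) n).obj M).obj N

/-- A finitely generated module `M` is totally reflexive (of G-dimension zero) if the
biduality map is an isomorphism and `Ext^i(M,R) = 0 = Ext^i(M^*,R)` for all `i > 0`. -/
def IsTotallyReflexive (M : ModuleCat.{u} R) : Prop :=
  Module.Finite R M ∧
  Function.Bijective (Module.Dual.eval R M) ∧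
  (∀ i : ℕ, 0 < i → IsZero (ExtMod R i M (ModuleCat.of R R))) ∧
  (∀ i : ℕ, 0 < i → IsZero (ExtMod R i (ModuleCat.of R (Module.Dual R M)) (ModuleCat.of R R)))

/-- `M` admits a resolution `0 → G_n → ⋯ → G_0 → M → 0` by totally reflexive modules. -/
def GDimLE (M : ModuleCat.{u} R) (n : ℕ) : Prop :=
  ∃ (G : ChainComplex (ModuleCat.{u} R) ℕ) (ε : G.X 0 ⟶ M),
    (∀ i, i ≤ n → IsTotallyReflexive R (G.X i)) ∧
    (∀ i, n < i → IsZero (G.X i)) ∧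
    Epi ε ∧
    (∃ w : G.d 1 0 ≫ ε = 0, (ShortComplex.mk (G.d 1 0) ε w).Exact) ∧
    (∀ i, 0 < i → G.ExactAt i)

/-- `M` has finite Gorenstein dimension. -/
def HasFiniteGDim (M : ModuleCat.{u} R) : Prop := ∃ n, GDimLE R M n

/-- The Gorenstein dimension of `M`, as an element of `ℕ∞`. -/
def gdim (M : ModuleCat.{u} R) : ℕ∞ :=
  sInf {c : ℕ∞ | ∃ n : ℕ, c = n ∧ GDimLE R M n}

/-- `M` admits a projective resolution of length at most `n`. -/
def PdLE (M : ModuleCat.{u} R) (n : ℕ) : Prop :=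
  ∃ (G : ChainComplex (ModuleCat.{u} R) ℕ) (ε : G.X 0 ⟶ M),
    (∀ i, Projective (G.X i)) ∧
    (∀ i, n < i → IsZero (G.X i)) ∧
    Epi ε ∧
    (∃ w : G.d 1 0 ≫ ε = 0, (ShortComplex.mk (G.d 1 0) ε w).Exact) ∧
    (∀ i, 0 < i → G.ExactAt i)

/-- `M` has finite projective dimension. -/
def HasFinitePd (M : ModuleCat.{u} R) : Prop := ∃ n, PdLE R M n

/-- The projective dimension of `M`, as an element of `ℕ∞`. -/
def pdim (M : ModuleCat.{u} R) : ℕ∞ :=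
  sInf {c : ℕ∞ | ∃ n : ℕ, c = n ∧ PdLE R M n}

/-- `M` admits an injective resolution `0 → M → I^0 → ⋯ → I^n → 0`. -/
def InjDimLE (M : ModuleCat.{u} R) (n : ℕ) : Prop :=
  ∃ (I : CochainComplex (ModuleCat.{u} R) ℕ) (ι : M ⟶ I.X 0),
    (∀ i, Injective (I.X i)) ∧
    (∀ i, n < i → IsZero (I.X i)) ∧
    Mono ι ∧
    (∃ w : ι ≫ I.d 0 1 = 0, (ShortComplex.mk ι (I.d 0 1) w).Exact) ∧
    (∀ i, 0 < i → I.ExactAt i)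

/-- `M` has finite injective dimension. -/
def HasFiniteInjDim (M : ModuleCat.{u} R) : Prop := ∃ n, InjDimLE R M n

/-- A Gorenstein local ring: a commutative Noetherian local ring of finite self-injective
dimension. -/
def IsGorensteinLocalRing : Prop :=
  IsLocalRing R ∧ IsNoetherianRing R ∧ HasFiniteInjDim R (ModuleCat.of R R)

/-- The grade of a module: `grade M = inf { i | Ext^i(M,R) ≠ 0 }`. -/
def gradeM (M : ModuleCat.{u} R) : ℕ∞ :=
  sInf {c : ℕ∞ | ∃ i : ℕ, c = i ∧ ¬ IsZero (ExtMod R i M (ModuleCat.of R R))}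

/-- A module is G-perfect if its grade equals its Gorenstein dimension. -/
def IsGPerfect (M : ModuleCat.{u} R) : Prop := gradeM R M = gdim R M

/-- An ideal `c` is perfect if `grade (R/c) = pd (R/c)`. -/
def IsPerfectIdeal (c : Ideal R) : Prop :=
  gradeM R (ModuleCat.of R (R ⧸ c)) = pdim R (ModuleCat.of R (R ⧸ c))

/-- A complete resolution `T → P → M` of `M`: `P → M` is a resolution by finite projective
modules, `T` is a totally acyclic complex of finite projective modules, and `θ i` is an
isomorphism for all `i ≫ 0`. -/
structure CompleteResolution (M : ModuleCat.{u} R) where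
  T : ChainComplex (ModuleCat.{u} R) ℤ
  P : ChainComplex (ModuleCat.{u} R) ℤ
  θ : T ⟶ P
  π : P.X 0 ⟶ M
  projT : ∀ i, Projective (T.X i)
  fgT : ∀ i, Module.Finite R (T.X i)
  projP : ∀ i, Projective (P.X i)
  fgP : ∀ i, Module.Finite R (P.X i)
  zeroP : ∀ i : ℤ, i < 0 → IsZero (P.X i)
  epiπ : Epi π
  wπ : P.d 1 0 ≫ π = 0
  exact0 : (ShortComplex.mk (P.d 1 0) π wπ).Exact
  exactP : ∀ i : ℤ, 0 < i → P.ExactAt i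
  exactT : ∀ i : ℤ, T.ExactAt i
  exactTdual : ∀ i : ℤ, (T.linearYonedaObj R (ModuleCat.of R R)).ExactAt i
  iso_eventually : ∃ n₀ : ℤ, ∀ i : ℤ, n₀ ≤ i → IsIso (θ.f i)

/-- Tate cohomology `Êxt^i(M,N) = H^i(Hom(T,N))` computed from a complete resolution of `M`. -/
def TateExt {M : ModuleCat.{u} R} (C : CompleteResolution R M) (N : ModuleCat.{u} R)
    (i : ℤ) : ModuleCat.{u} R :=
  (C.T.linearYonedaObj R N).homology i

/-- Tate homology `T̂or_i(M,N) = H_i(T ⊗ N)` computed from a complete resolution of `M`. -/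
def TateTor {M : ModuleCat.{u} R} (C : CompleteResolution R M) (N : ModuleCat.{u} R)
    (i : ℤ) : ModuleCat.{u} R :=
  ((((tensoringRight (ModuleCat.{u} R)).obj N).mapHomologicalComplex _).obj C.T).homology i

/-- The depth of a module over a local ring: the supremum of the lengths of the
`M`-regular sequences contained in the maximal ideal. -/
def moduleDepth [IsLocalRing R] (M : Type u) [AddCommGroup M] [Module R M] : ℕ∞ :=
  sSup {c : ℕ∞ | ∃ rs : List R, c = rs.length ∧
    (∀ r ∈ rs, r ∈ IsLocalRing.maximalIdeal R) ∧ RingTheory.Sequence.IsRegular M rs}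

/-- `E` is an injective envelope of the residue field `k`: an injective module which is an
essential extension of `k`. -/
def IsInjectiveEnvelopeOfResidueField [IsLocalRing R] (E : Type u) [AddCommGroup E]
    [Module R E] : Prop :=
  Injective (ModuleCat.of R E) ∧
  ∃ ι : IsLocalRing.ResidueField R →ₗ[R] E,
    Function.Injective ι ∧
    ∀ N : Submodule R E, N ≠ ⊥ → N ⊓ LinearMap.range ι ≠ ⊥


/-- A minimal free resolution `⋯ → F_1 → F_0 → M → 0` of a finitely generated module over a
local ring, recorded by its Betti numbers `b n` and differentials with image inside
`m • F_n`. -/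
structure MinFreeRes [IsLocalRing R] (M : Type u) [AddCommGroup M] [Module R M] where
  b : ℕ → ℕ
  d : ∀ n : ℕ, ((Fin (b (n+1)) → R) →ₗ[R] (Fin (b n) → R))
  aug : (Fin (b 0) → R) →ₗ[R] M
  aug_surj : Function.Surjective aug
  exact_zero : LinearMap.ker aug = LinearMap.range (d 0)
  exact_succ : ∀ n, LinearMap.ker (d n) = LinearMap.range (d (n+1))
  minimal : ∀ n, LinearMap.range (d n) ≤ (IsLocalRing.maximalIdeal R) • ⊤

/-- The Betti numbers of `M` are eventually bounded by `γ · n^(c-1)`. -/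
def CxLE [IsLocalRing R] (M : Type u) [AddCommGroup M] [Module R M] (c : ℕ) : Prop :=
  ∃ (F : MinFreeRes R M) (γ : ℝ) (n₀ : ℕ),
    ∀ n : ℕ, n₀ ≤ n → (F.b n : ℝ) ≤ γ * (n : ℝ) ^ ((c : ℤ) - 1)

/-- The complexity of a module: the least `c` such that the Betti numbers are eventually
bounded by `γ · n^(c-1)` for some `γ`. -/
def complexity [IsLocalRing R] (M : Type u) [AddCommGroup M] [Module R M] : ℕ∞ :=
  sInf {e : ℕ∞ | ∃ c : ℕ, e = c ∧ CxLE R M c}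

/-- The pushout `K_η` of a map `f : Ω^{j+1} M → M` (representing a degree-`(j+1)`
homogeneous element `η` of `Ext^*(M,M)`) along the inclusion `Ω^{j+1} M ↪ F_j`: the
cokernel of `(f, -incl) : Ω^{j+1} M → M ⊕ F_j`. -/
abbrev PushoutMod [IsLocalRing R] {M : Type u} [AddCommGroup M] [Module R M]
    (F : MinFreeRes R M) (j : ℕ) (f : LinearMap.range (F.d j) →ₗ[R] M) : Type u :=
  (M × (Fin (F.b j) → R)) ⧸
    LinearMap.range (LinearMap.prod f (-(LinearMap.range (F.d j)).subtype))

/-- Auxiliary predicate: `M` has reducible complexity, with recursion depth `≤ c`. -/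
def RedCxAux [IsLocalRing R] :
    ℕ → ∀ (M : Type u) (_ : AddCommGroup M) (_ : Module R M), Prop
  | 0, M, g, m =>
      letI := g; letI := m
      HasFinitePd R (ModuleCat.of R M)
  | (c+1), M, g, m =>
      letI := g; letI := m
      HasFinitePd R (ModuleCat.of R M) ∨
      (complexity R M < ⊤ ∧ 0 < complexity R M ∧
        ∃ (j : ℕ) (F : MinFreeRes R M) (f : LinearMap.range (F.d j) →ₗ[R] M),
          complexity R (PushoutMod R F j f) < complexity R M ∧
          moduleDepth R (PushoutMod R F j f) = moduleDepth R M ∧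
          RedCxAux c (PushoutMod R F j f) inferInstance inferInstance)

/-- `M` has reducible complexity. -/
def HasReducibleComplexity [IsLocalRing R] (M : Type u) [AddCommGroup M] [Module R M] :
    Prop :=
  ∃ c : ℕ, RedCxAux R c M inferInstance inferInstance

/-- `L` is (isomorphic to) `λ N = Ω Tr N`, computed from a minimal free presentation of `N`
over the local ring `S`. -/
def IsLambdaOf (S : Type u) [CommRing S] [IsLocalRing S]
    (N L : Type u) [AddCommGroup N] [Module S N] [AddCommGroup L] [Module S L] : Prop :=
  ∃ (n₀ n₁ : ℕ) (g : (Fin n₀ → S) →ₗ[S] N) (f : (Fin n₁ → S) →ₗ[S] (Fin n₀ → S)),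
    Function.Surjective g ∧
    LinearMap.range f = LinearMap.ker g ∧
    LinearMap.ker g ≤ (IsLocalRing.maximalIdeal S) • ⊤ ∧
    LinearMap.ker f ≤ (IsLocalRing.maximalIdeal S) • ⊤ ∧
    Nonempty (L ≃ₗ[S] LinearMap.range f.dualMap)

/-- `M` and `N` are linked by the ideal `c`: both are annihilated by `c` (hence are
`R/c`-modules) and `M ≅ λ_{R/c} N`, `N ≅ λ_{R/c} M`. -/
def LinkedBy (c : Ideal R) (M N : Type u) [AddCommGroup M] [Module (R ⧸ c) M]
    [AddCommGroup N] [Module (R ⧸ c) N] [IsLocalRing (R ⧸ c)] : Prop :=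
  IsLambdaOf (R ⧸ c) N M ∧ IsLambdaOf (R ⧸ c) M N

section

variable {R}

section

/-- `ε : P₀ → M` exhibits the chain complex `P` as a resolution of `M`. -/
structure IsResolution (P : ChainComplex (ModuleCat.{u} R) ℕ) {M : ModuleCat.{u} R}
    (ε : P.X 0 ⟶ M) : Prop where
  surjective : Function.Surjective ε.hom
  exact_zero : Function.Exact (P.d 1 0).hom ε.hom
  exact_succ : ∀ k, Function.Exact (P.d (k + 2) (k + 1)).hom (P.d (k + 1) k).hom

namespace IsResolution

variable {P : ChainComplex (ModuleCat.{u} R) ℕ} {M : ModuleCat.{u} R} {ε : P.X 0 ⟶ M}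

lemma comp_eq_zero (h : IsResolution P ε) : P.d 1 0 ≫ ε = 0 := by
  ext x
  exact h.exact_zero.apply_apply_eq_zero x

lemma exactAt_succ (h : IsResolution P ε) (n : ℕ) : P.ExactAt (n + 1) := by
  rw [HomologicalComplex.exactAt_iff' _ (n + 1 + 1) (n + 1) n (by simp) (by simp),
    ShortComplex.ShortExact.moduleCat_exact_iff_function_exact]
  exact h.exact_succ n

lemma quasiIso (h : IsResolution P ε) :
    QuasiIso ((ChainComplex.toSingle₀Equiv P M).symm ⟨ε, h.comp_eq_zero⟩) := ⟨fun n => by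
  cases n with
  | zero =>
    rw [ChainComplex.quasiIsoAt₀_iff, ShortComplex.quasiIso_iff_of_zeros' _ ?_ ?_ ?_]
    have hex : (ShortComplex.mk _ _ h.comp_eq_zero).Exact ∧
        Epi (ShortComplex.mk _ _ h.comp_eq_zero).g := by
      refine ⟨?_, (ModuleCat.epi_iff_surjective _).2 h.surjective⟩
      rw [ShortComplex.ShortExact.moduleCat_exact_iff_function_exact]
      exact h.exact_zero
    · refine (ShortComplex.exact_and_epi_g_iff_of_iso ?_).2 hex
      exact ShortComplex.isoMk (Iso.refl _) (Iso.refl _) (Iso.refl _)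
        ((Category.id_comp (P.d 1 0)).trans (Category.comp_id (P.d 1 0)).symm)
        ((Category.id_comp ε).trans (Category.comp_id ε).symm)
    all_goals
      simp
      exact rfl
  | succ n =>
    rw [quasiIsoAt_iff_exactAt']
    · exact h.exactAt_succ n
    · apply ChainComplex.exactAt_succ_single_obj⟩

/-- A resolution by projective modules, as a projective resolution. -/
def toProjectiveResolution (h : IsResolution P ε) (hP : ∀ n, Projective (P.X n)) :
    ProjectiveResolution M where
  complex := P
  projective := hP
  π := (ChainComplex.toSingle₀Equiv P M).symm ⟨ε, h.comp_eq_zero⟩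
  quasiIso := h.quasiIso

end IsResolution

lemma CategoryTheory.ProjectiveResolution.isResolution {M : ModuleCat.{u} R}
    (Q : ProjectiveResolution M) : IsResolution Q.complex (Q.π.f 0) where
  surjective := (ModuleCat.epi_iff_surjective _).1 inferInstance
  exact_zero := (ShortComplex.ShortExact.moduleCat_exact_iff_function_exact _).1 Q.exact₀
  exact_succ k := (ShortComplex.ShortExact.moduleCat_exact_iff_function_exact _).1 (Q.exact_succ k)

/-- The chain complex obtained by dropping the term in degree zero. -/
def dropZero (P : ChainComplex (ModuleCat.{u} R) ℕ) : ChainComplex (ModuleCat.{u} R) ℕ where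
  X k := P.X (k + 1)
  d i j := P.d (i + 1) (j + 1)
  shape i j hij := P.shape _ _ fun h => hij (by simp only [ComplexShape.down_Rel] at h ⊢; omega)
  d_comp_d' _ _ _ _ _ := P.d_comp_d _ _ _

/-- The augmentation of `dropZero P` onto the first syzygy. -/
def IsResolution.syzygyMap {P : ChainComplex (ModuleCat.{u} R) ℕ} {M : ModuleCat.{u} R}
    {ε : P.X 0 ⟶ M} (h : IsResolution P ε) :
    (dropZero P).X 0 ⟶ ModuleCat.of R (LinearMap.ker ε.hom) :=
  ModuleCat.ofHom ((P.d 1 0).hom.codRestrict _ fun x => h.exact_zero.apply_apply_eq_zero x)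

lemma IsResolution.dropZero {P : ChainComplex (ModuleCat.{u} R) ℕ} {M : ModuleCat.{u} R}
    {ε : P.X 0 ⟶ M} (h : IsResolution P ε) : IsResolution (dropZero P) h.syzygyMap where
  surjective := by
    rintro ⟨x, hx⟩
    obtain ⟨y, rfl⟩ := (h.exact_zero x).1 hx
    exact ⟨y, rfl⟩
  exact_zero := fun y =>
    ⟨fun hy => (h.exact_succ 0 y).1 (congrArg Subtype.val hy),
      fun hy => Subtype.ext ((h.exact_succ 0 y).2 hy)⟩
  exact_succ k := h.exact_succ (k + 1)

section FiniteFree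

/-- The rank of a finite free cover of a finite module. -/
def coverRank (K : ModuleCat.{u} R) [Module.Finite R K] : ℕ :=
  (Module.Finite.exists_fin' R K).choose

/-- A finite free cover of a finite module. -/
def cover (K : ModuleCat.{u} R) [Module.Finite R K] : (Fin (coverRank K) → R) →ₗ[R] K :=
  (Module.Finite.exists_fin' R K).choose_spec.choose

lemma cover_surjective (K : ModuleCat.{u} R) [Module.Finite R K] :
    Function.Surjective (cover K) :=
  (Module.Finite.exists_fin' R K).choose_spec.choose_spec

variable [IsNoetherianRing R]

/-- The successive syzygies of a finite module with respect to chosen finite free covers. -/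
def finiteSyzygy (M : ModuleCat.{u} R) (hM : Module.Finite R M) :
    ℕ → {K : ModuleCat.{u} R // Module.Finite R K}
  | 0 => ⟨M, hM⟩
  | n + 1 =>
    have := (finiteSyzygy M hM n).2
    ⟨ModuleCat.of R (LinearMap.ker (cover (finiteSyzygy M hM n).1)), inferInstance⟩

instance (M : ModuleCat.{u} R) (hM : Module.Finite R M) (n : ℕ) :
    Module.Finite R (finiteSyzygy M hM n).1 := (finiteSyzygy M hM n).2

/-- The differentials of the finite free resolution built from `finiteSyzygy`. -/
def finiteFreeD (M : ModuleCat.{u} R) (hM : Module.Finite R M) (n : ℕ) :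
    ModuleCat.of R (Fin (coverRank (finiteSyzygy M hM (n + 1)).1) → R) ⟶
      ModuleCat.of R (Fin (coverRank (finiteSyzygy M hM n).1) → R) :=
  ModuleCat.ofHom ((LinearMap.ker (cover (finiteSyzygy M hM n).1)).subtype ∘ₗ
    cover (finiteSyzygy M hM (n + 1)).1)

lemma finiteFreeD_exact (M : ModuleCat.{u} R) (hM : Module.Finite R M) (n : ℕ) :
    Function.Exact (finiteFreeD M hM n).hom (cover (finiteSyzygy M hM n).1) := fun x => by
  constructor
  · intro hx
    obtain ⟨y, hy⟩ := cover_surjective (finiteSyzygy M hM (n + 1)).1 ⟨x, hx⟩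
    exact ⟨y, congrArg Subtype.val hy⟩
  · rintro ⟨y, rfl⟩
    exact (cover (finiteSyzygy M hM (n + 1)).1 y).2

lemma finiteFreeD_exact_succ (M : ModuleCat.{u} R) (hM : Module.Finite R M) (n : ℕ) :
    Function.Exact (finiteFreeD M hM (n + 1)).hom (finiteFreeD M hM n).hom := fun x => by
  rw [← finiteFreeD_exact M hM (n + 1) x]
  exact ⟨fun h => Subtype.ext h, fun h => congrArg Subtype.val h⟩

/-- A finite module over a Noetherian ring has a resolution by finite free modules. -/
lemma exists_finiteFree_resolution (M : ModuleCat.{u} R) (hM : Module.Finite R M) :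
    ∃ (P : ChainComplex (ModuleCat.{u} R) ℕ) (ε : P.X 0 ⟶ M), IsResolution P ε ∧
      (∀ k, Module.Free R (P.X k)) ∧ ∀ k, Module.Finite R (P.X k) := by
  let F : ℕ → ModuleCat.{u} R :=
    fun n => ModuleCat.of R (Fin (coverRank (finiteSyzygy M hM n).1) → R)
  have sq : ∀ n, finiteFreeD M hM (n + 1) ≫ finiteFreeD M hM n = 0 := fun n => by
    ext1
    exact (finiteFreeD_exact_succ M hM n).linearMap_comp_eq_zero
  have hd : ∀ n, (ChainComplex.of F (finiteFreeD M hM) sq).d (n + 1) n = finiteFreeD M hM n :=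
    fun n => ChainComplex.of_d F _ n
  refine ⟨ChainComplex.of F (finiteFreeD M hM) sq, ModuleCat.ofHom (cover (finiteSyzygy M hM 0).1),
    ⟨cover_surjective M, ?_, fun k => ?_⟩, fun k => ?_, fun k => ?_⟩
  · exact (hd 0) ▸ finiteFreeD_exact M hM 0
  · rw [hd k, hd (k + 1)]
    exact finiteFreeD_exact_succ M hM k
  · exact inferInstanceAs (Module.Free R (Fin _ → R))
  · exact inferInstanceAs (Module.Finite R (Fin _ → R))

end FiniteFree

end

section

lemma linearYonedaObj_exactAt_iff {α : Type*} [AddRightCancelSemigroup α] [One α]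
    (X : ChainComplex (ModuleCat.{u} R) α) (Y : ModuleCat.{u} R) {i j k : α}
    (hi : (ComplexShape.up α).prev j = i) (hk : (ComplexShape.up α).next j = k) :
    (X.linearYonedaObj R Y).ExactAt j ↔
      ∀ f : X.X j ⟶ Y, X.d k j ≫ f = 0 → ∃ g : X.X i ⟶ Y, X.d j i ≫ g = f := by
  rw [HomologicalComplex.exactAt_iff' _ i j k hi hk,
    ShortComplex.ShortExact.moduleCat_exact_iff_function_exact]
  refine ⟨fun h f hf => (h f).1 hf, fun h f => ⟨fun hf => h f hf, ?_⟩⟩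
  rintro ⟨g, rfl⟩
  let g' : X.X i ⟶ Y := g
  exact (by simp : X.d k j ≫ X.d j i ≫ g' = 0)

variable {M : ModuleCat.{u} R}

/-- `Ext` in positive degrees vanishes iff cocycles are coboundaries. -/
lemma CategoryTheory.ProjectiveResolution.subsingleton_ext_succ_iff
    (P : ProjectiveResolution M) (N : ModuleCat.{u} R) (n : ℕ) :
    Subsingleton (Abelian.Ext.{u} M N (n + 1)) ↔
      ∀ f : P.complex.X (n + 1) ⟶ N, P.complex.d (n + 2) (n + 1) ≫ f = 0 →
        ∃ g : P.complex.X n ⟶ N, P.complex.d (n + 1) n ≫ g = f := by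
  constructor
  · intro h f hf
    exact (P.extMk_eq_zero_iff f (n + 2) rfl hf n rfl).1 (Subsingleton.elim _ _)
  · intro h
    refine subsingleton_of_forall_eq 0 fun e => ?_
    obtain ⟨f, hf, rfl⟩ := P.extMk_surjective e (n + 2) rfl
    exact (P.extMk_eq_zero_iff f (n + 2) rfl hf n rfl).2 (h f hf)

lemma isZero_extMod_iff (M N : ModuleCat.{u} R) (n : ℕ) :
    IsZero (ExtMod R n M N) ↔ Subsingleton (Abelian.Ext.{u} M N n) := by
  let P := projectiveResolution M
  let ε : P.complex.X 0 ⟶ M := P.π.f 0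
  have hε : P.complex.d 1 0 ≫ ε = 0 := P.complex_d_comp_π_f_zero
  have : Epi ε := inferInstanceAs (Epi (P.π.f 0))
  have hex : (ShortComplex.mk _ _ hε).Exact := P.exact₀
  have h1 : IsZero (ExtMod R n M N) ↔ (P.complex.linearYonedaObj R N).ExactAt n := by
    rw [HomologicalComplex.exactAt_iff_isZero_homology]
    exact (P.isoExt n N).isZero_iff
  rw [h1]
  cases n with
  | zero =>
    rw [linearYonedaObj_exactAt_iff P.complex N (i := 0) (k := 1) (by simp) (by simp),
      Abelian.Ext.addEquiv₀.toEquiv.subsingleton_congr]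
    constructor
    · intro h
      refine subsingleton_of_forall_eq 0 fun f => ?_
      obtain ⟨g, hg⟩ := h (ε ≫ f) (by rw [reassoc_of% hε, zero_comp])
      rw [P.complex.shape 0 0 (by simp), zero_comp] at hg
      exact (cancel_epi ε).1 (hg.symm.trans comp_zero.symm)
    · intro h f hf
      refine ⟨0, ?_⟩
      obtain ⟨g, hg⟩ : ∃ g : M ⟶ N, ε ≫ g = f :=
        ⟨hex.desc f hf, hex.g_desc f hf⟩
      rw [← hg, Subsingleton.elim g 0, comp_zero, comp_zero]
  | succ n =>
    rw [linearYonedaObj_exactAt_iff P.complex N (i := n) (k := n + 2) (by simp) (by simp),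
      P.subsingleton_ext_succ_iff]

end

section

/-- A short exact sequence of linear maps gives a short exact sequence in `ModuleCat`. -/
lemma shortExact_of_linearMap {A B C : Type u} [AddCommGroup A] [AddCommGroup B] [AddCommGroup C]
    [Module R A] [Module R B] [Module R C] {f : A →ₗ[R] B} {g : B →ₗ[R] C}
    (hf : Function.Injective f) (hfg : Function.Exact f g) (hg : Function.Surjective g) :
    (ShortComplex.mk (ModuleCat.ofHom f) (ModuleCat.ofHom g)
      (by ext1; exact hfg.linearMap_comp_eq_zero)).ShortExact where
  exact := (ShortComplex.ShortExact.moduleCat_exact_iff_function_exact _).2 hfg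
  mono_f := (ModuleCat.mono_iff_injective _).2 hf
  epi_g := (ModuleCat.epi_iff_surjective _).2 hg

/-- Every `Ext^i(M, N)` is annihilated by a power of `s`. -/
def ExtPowTorsion (s : R) (M N : Type u) [AddCommGroup M] [AddCommGroup N] [Module R M]
    [Module R N] : Prop :=
  ∀ i, ∃ k : ℕ, ∀ e : Abelian.Ext.{u} (ModuleCat.of R M) (ModuleCat.of R N) i, s ^ k • e = 0

section

variable {s : R} {M A B C : Type u} [AddCommGroup M] [AddCommGroup A] [AddCommGroup B]
    [AddCommGroup C] [Module R M] [Module R A] [Module R B] [Module R C]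

lemma ExtPowTorsion.of_shortExact {f : A →ₗ[R] B} {g : B →ₗ[R] C}
    (hf : Function.Injective f) (hfg : Function.Exact f g) (hg : Function.Surjective g)
    (hA : ExtPowTorsion s M A) (hB : ExtPowTorsion s M B) : ExtPowTorsion s M C := fun i => by
  have hS := shortExact_of_linearMap hf hfg hg
  obtain ⟨k, hk⟩ := hA (i + 1)
  obtain ⟨l, hl⟩ := hB i
  refine ⟨l + k, fun e => ?_⟩
  obtain ⟨e', he'⟩ := Abelian.Ext.covariant_sequence_exact₃ (ModuleCat.of R M) hS (s ^ k • e) rfl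
    (by rw [Abelian.Ext.smul_comp]; exact hk _)
  rw [pow_add, mul_smul, ← he', ← Abelian.Ext.smul_comp, hl, Abelian.Ext.zero_comp]

lemma ExtPowTorsion.of_pow_smul_eq_zero {k : ℕ} (hA : ∀ a : A, s ^ k • a = 0) :
    ExtPowTorsion s M A := fun i => ⟨k, fun e => by
  rw [Abelian.Ext.smul_eq_comp_mk₀]
  have : s ^ k • 𝟙 (ModuleCat.of R A) = 0 := by ext a; exact hA a
  rw [this, Abelian.Ext.mk₀_zero, Abelian.Ext.comp_zero]⟩

lemma ExtPowTorsion.of_linearEquiv (e : A ≃ₗ[R] B) (hA : ExtPowTorsion s M A) :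
    ExtPowTorsion s M B :=
  ExtPowTorsion.of_shortExact (A := PUnit.{u + 1}) (f := (0 : PUnit.{u + 1} →ₗ[R] A))
    (g := e.toLinearMap)
    (fun _ _ _ => rfl) (fun x => by simpa using (eq_comm : x = 0 ↔ 0 = x)) e.surjective
    (ExtPowTorsion.of_pow_smul_eq_zero (k := 0) fun _ => rfl) hA

end

variable [IsNoetherianRing R] {M : Type u} [AddCommGroup M] [Module R M] [Module.Finite R M]

/-- If `s` is nilpotent on all `Ext^i(M, R)` then it is nilpotent on `M`. -/
theorem exists_pow_smul_eq_zero_of_extPowTorsion {s : R} (h : ExtPowTorsion s M R) :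
    ∃ k : ℕ, ∀ m : M, s ^ k • m = 0 := by
  by_contra hcon
  have hrad : s ∉ (Module.annihilator R M).radical := by
    rintro ⟨k, hk⟩
    exact hcon ⟨k, Module.mem_annihilator.1 hk⟩
  rw [Ideal.radical_eq_sInf, Ideal.mem_sInf] at hrad
  push Not at hrad
  obtain ⟨p, ⟨hp, hpp⟩, hsp⟩ := hrad
  let S : Set (Ideal R) := {I | I ≤ p ∧ ExtPowTorsion s M (R ⧸ I)}
  have hS : S.Nonempty :=
    ⟨⊥, bot_le, h.of_linearEquiv (Submodule.quotEquivOfEqBot ⊥ rfl).symm⟩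
  obtain ⟨I, ⟨hIp, hI⟩, hmax⟩ := set_has_maximal_iff_noetherian.2 ‹IsNoetherian R R› S hS
  have hmax' : ∀ J ∈ S, I ≤ J → J ≤ I := fun J hJ hIJ => by
    by_contra hJI
    exact hmax J hJ (lt_of_le_not_ge hIJ hJI)
  -- `s` is regular on `R ⧸ I`
  have hsreg : ∀ r : R, s * r ∈ I → r ∈ I := by
    intro r hr
    let J : Ideal R := I ⊔ Ideal.span {r}
    refine hmax' J ⟨?_, ?_⟩ le_sup_left (Ideal.mem_sup_right (Ideal.mem_span_singleton_self r))
    · refine sup_le hIp ((Ideal.span_singleton_le_iff_mem _).2 ?_)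
      exact (hpp.mem_or_mem (hIp hr)).resolve_left hsp
    · let g : (R ⧸ I) →ₗ[R] R ⧸ J := Submodule.factor le_sup_left
      refine ExtPowTorsion.of_shortExact (f := (LinearMap.ker g).subtype) (g := g)
        Subtype.val_injective (LinearMap.exact_subtype_ker_map g)
        (Submodule.factor_surjective _) (ExtPowTorsion.of_pow_smul_eq_zero (k := 1) ?_) hI
      rintro ⟨a, ha⟩
      obtain ⟨a, rfl⟩ := Submodule.Quotient.mk_surjective _ a
      have ha' : a ∈ J := (Submodule.Quotient.mk_eq_zero _).1 ha
      obtain ⟨i, hi, y, hy, rfl⟩ := Submodule.mem_sup.1 ha'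
      obtain ⟨c, rfl⟩ := Ideal.mem_span_singleton'.1 hy
      refine Subtype.ext ((Submodule.Quotient.mk_eq_zero _).2 ?_)
      have : s ^ 1 • (i + c * r) = s * i + c * (s * r) := by simp; ring
      refine (this ▸ ?_ : s ^ 1 • (i + c * r) ∈ I)
      exact I.add_mem (Ideal.mul_mem_left I _ hi) (Ideal.mul_mem_left I _ hr)
  have hspow : ∀ (k : ℕ) (r : R), s ^ k * r ∈ I → r ∈ I := by
    intro k
    induction k with
    | zero => intro r hr; simpa using hr
    | succ k ih => intro r hr; exact hsreg r (ih _ (by rwa [← mul_assoc, ← pow_succ]))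
  have hHom : Subsingleton (M →ₗ[R] R ⧸ I) := by
    obtain ⟨k, hk⟩ := hI 0
    refine subsingleton_of_forall_eq 0 fun f => ?_
    have h0 := hk (Abelian.Ext.mk₀ (ModuleCat.ofHom f))
    rw [← Abelian.Ext.mk₀_smul, Abelian.Ext.mk₀_eq_zero_iff] at h0
    ext m
    have h1 : s ^ k • f m = 0 := congrArg (fun φ => φ.hom m) h0
    obtain ⟨r, hr⟩ := Submodule.Quotient.mk_surjective _ (f m)
    rw [← hr] at h1 ⊢
    exact (Submodule.Quotient.mk_eq_zero _).2 (hspow k r ((Submodule.Quotient.mk_eq_zero _).1 h1))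
  obtain ⟨x, hx, hxreg⟩ := IsSMulRegular.subsingleton_linearMap_iff.1 hHom
  have hxI : x ∈ I := by
    let J : Ideal R := I ⊔ Ideal.span {x}
    refine hmax' J ⟨?_, ?_⟩ le_sup_left (Ideal.mem_sup_right (Ideal.mem_span_singleton_self x))
    · exact sup_le hIp ((Ideal.span_singleton_le_iff_mem _).2 (hp hx))
    · refine ExtPowTorsion.of_shortExact (f := LinearMap.lsmul R (R ⧸ I) x)
        (g := (Submodule.factor le_sup_left : (R ⧸ I) →ₗ[R] R ⧸ J)) hxreg ?_
        (Submodule.factor_surjective _) hI hI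
      intro a
      obtain ⟨a, rfl⟩ := Submodule.Quotient.mk_surjective _ a
      refine (Submodule.Quotient.mk_eq_zero J (x := a)).trans ?_
      constructor
      · intro ha
        obtain ⟨i, hi, y, hy, rfl⟩ := Submodule.mem_sup.1 ha
        obtain ⟨c, rfl⟩ := Ideal.mem_span_singleton'.1 hy
        refine ⟨Submodule.Quotient.mk c, ?_⟩
        refine (Submodule.Quotient.eq _).2 ?_
        have : x • c - (i + c * x) = -i := by simp; ring
        rw [this]
        exact I.neg_mem hi
      · rintro ⟨c, hc⟩
        obtain ⟨c, rfl⟩ := Submodule.Quotient.mk_surjective _ c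
        have h1 : x • c - a ∈ I := (Submodule.Quotient.eq _).1 hc
        have h2 : a = -(x • c - a) + c * x := by simp; ring
        rw [h2]
        exact J.add_mem (Ideal.mem_sup_left (I.neg_mem h1))
          (Ideal.mem_sup_right (Ideal.mem_span_singleton'.2 ⟨c, rfl⟩))
  have h10 : (Submodule.Quotient.mk 1 : R ⧸ I) = 0 := hxreg (by
    change x • Submodule.Quotient.mk 1 = x • (0 : R ⧸ I)
    rw [smul_zero, ← Submodule.Quotient.mk_smul]
    exact (Submodule.Quotient.mk_eq_zero _).2 (by simpa using hxI))
  exact hsp (by simpa using p.mul_mem_left s (hIp ((Submodule.Quotient.mk_eq_zero _).1 h10)))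

end

section

section LongExact

variable {A B C Y : Type u} [AddCommGroup A] [AddCommGroup B] [AddCommGroup C] [AddCommGroup Y]
  [Module R A] [Module R B] [Module R C] [Module R Y] {f : A →ₗ[R] B} {g : B →ₗ[R] C}

variable (R) in
/-- Vanishing of `Ext^i(A, Y)`. -/
abbrev ExtVan (i : ℕ) (A Y : Type u) [AddCommGroup A] [AddCommGroup Y] [Module R A]
    [Module R Y] : Prop :=
  Subsingleton (Abelian.Ext.{u} (ModuleCat.of R A) (ModuleCat.of R Y) i)

lemma extVan_left (hf : Function.Injective f) (hfg : Function.Exact f g)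
    (hg : Function.Surjective g) {i : ℕ} (hB : ExtVan R i B Y) (hC : ExtVan R (i + 1) C Y) :
    ExtVan R i A Y := by
  refine subsingleton_of_forall_eq 0 fun e => ?_
  obtain ⟨x, rfl⟩ := Abelian.Ext.contravariant_sequence_exact₁
    (shortExact_of_linearMap hf hfg hg) (ModuleCat.of R Y) e (add_comm 1 i)
    (Subsingleton.elim (h := hC) _ _)
  rw [Subsingleton.elim (h := hB) x 0, Abelian.Ext.comp_zero]

lemma extVan_middle (hf : Function.Injective f) (hfg : Function.Exact f g)
    (hg : Function.Surjective g) {i : ℕ} (hA : ExtVan R i A Y) (hC : ExtVan R i C Y) :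
    ExtVan R i B Y := by
  refine subsingleton_of_forall_eq 0 fun e => ?_
  obtain ⟨x, rfl⟩ := Abelian.Ext.contravariant_sequence_exact₂
    (shortExact_of_linearMap hf hfg hg) (ModuleCat.of R Y) e
    (Subsingleton.elim (h := hA) _ _)
  rw [Subsingleton.elim (h := hC) x 0, Abelian.Ext.comp_zero]

lemma extVan_right (hf : Function.Injective f) (hfg : Function.Exact f g)
    (hg : Function.Surjective g) {i : ℕ} (hA : ExtVan R i A Y) (hB : ExtVan R (i + 1) B Y) :
    ExtVan R (i + 1) C Y := by
  refine subsingleton_of_forall_eq 0 fun e => ?_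
  obtain ⟨x, rfl⟩ := Abelian.Ext.contravariant_sequence_exact₃
    (shortExact_of_linearMap hf hfg hg) (ModuleCat.of R Y) e
    (Subsingleton.elim (h := hB) _ _) (add_comm 1 i)
  rw [Subsingleton.elim (h := hA) x 0, Abelian.Ext.comp_zero]

lemma extVan_one_right (hf : Function.Injective f) (hfg : Function.Exact f g)
    (hg : Function.Surjective g) (hext : ∀ a : A →ₗ[R] Y, ∃ b : B →ₗ[R] Y, b ∘ₗ f = a)
    (hB : ExtVan R 1 B Y) : ExtVan R 1 C Y := by
  refine subsingleton_of_forall_eq 0 fun e => ?_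
  have hS := shortExact_of_linearMap hf hfg hg
  obtain ⟨x, rfl⟩ := Abelian.Ext.contravariant_sequence_exact₃ hS (ModuleCat.of R Y) e
    (Subsingleton.elim (h := hB) _ _) (add_zero 1)
  obtain ⟨a, rfl⟩ := Abelian.Ext.addEquiv₀.symm.surjective x
  obtain ⟨b, hb⟩ := hext a.hom
  have hab : a = ModuleCat.ofHom f ≫ ModuleCat.ofHom b := by ext1; exact hb.symm
  rw [Abelian.Ext.addEquiv₀_symm_apply, hab, ← Abelian.Ext.mk₀_comp_mk₀,
    hS.extClass_comp_assoc]

lemma exists_extension_of_extVan (hf : Function.Injective f) (hfg : Function.Exact f g)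
    (hg : Function.Surjective g) (hC : ExtVan R 1 C Y) (a : A →ₗ[R] Y) :
    ∃ b : B →ₗ[R] Y, b ∘ₗ f = a := by
  have hS := shortExact_of_linearMap hf hfg hg
  obtain ⟨x, hx⟩ := Abelian.Ext.contravariant_sequence_exact₁ hS (ModuleCat.of R Y)
    (Abelian.Ext.mk₀ (ModuleCat.ofHom a)) (add_zero 1) (Subsingleton.elim (h := hC) _ _)
  obtain ⟨b, rfl⟩ := Abelian.Ext.addEquiv₀.symm.surjective x
  refine ⟨b.hom, ?_⟩
  rw [Abelian.Ext.addEquiv₀_symm_apply, Abelian.Ext.mk₀_comp_mk₀] at hx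
  exact congrArg ModuleCat.Hom.hom ((Abelian.Ext.mk₀_bijective _ _).1 hx)

end LongExact

end

section

section TotallyReflexive

variable (R) in
/-- Total reflexivity, with vanishing of `Ext` expressed through `ExtVan`. -/
structure TotRefl (G : Type u) [AddCommGroup G] [Module R G] : Prop where
  finite : Module.Finite R G
  bij : Function.Bijective (Module.Dual.eval R G)
  ext : ∀ i, ExtVan R (i + 1) G R
  ext_dual : ∀ i, ExtVan R (i + 1) (Module.Dual R G) R

lemma IsTotallyReflexive.totRefl {G : ModuleCat.{u} R} (h : IsTotallyReflexive R G) :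
    TotRefl R G where
  finite := h.1
  bij := h.2.1
  ext i := (isZero_extMod_iff _ _ _).1 (h.2.2.1 (i + 1) i.succ_pos)
  ext_dual i := (isZero_extMod_iff _ _ _).1 (h.2.2.2 (i + 1) i.succ_pos)

lemma extVan_succ_of_projective (F Y : Type u) [AddCommGroup F] [Module R F] [AddCommGroup Y]
    [Module R Y] [Module.Projective R F] (i : ℕ) : ExtVan R (i + 1) F Y := by
  have : Projective (ModuleCat.of R F) := (IsProjective.iff_projective F).1 ‹_›
  exact subsingleton_of_forall_eq 0 fun e => Abelian.Ext.eq_zero_of_projective e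

lemma TotRefl.of_free (F : Type u) [AddCommGroup F] [Module R F] [Module.Free R F]
    [Module.Finite R F] : TotRefl R F where
  finite := inferInstance
  bij := Module.bijective_dual_eval R F
  ext i := extVan_succ_of_projective F R i
  ext_dual i := extVan_succ_of_projective _ R i

variable {A B C : Type u} [AddCommGroup A] [AddCommGroup B] [AddCommGroup C]
  [Module R A] [Module R B] [Module R C] {f : A →ₗ[R] B} {g : B →ₗ[R] C}

lemma dualMap_exact (hfg : Function.Exact f g) (hg : Function.Surjective g) :
    Function.Exact g.dualMap f.dualMap := fun b => by
  constructor
  · intro hb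
    have hle : LinearMap.ker g ≤ LinearMap.ker b := by
      intro x hx
      obtain ⟨a, rfl⟩ := (hfg x).1 hx
      exact LinearMap.congr_fun hb a
    let e := g.quotKerEquivOfSurjective hg
    refine ⟨(LinearMap.ker g).liftQ b hle ∘ₗ e.symm.toLinearMap, ?_⟩
    ext x
    have : e.symm (g x) = Submodule.Quotient.mk x := by
      rw [LinearEquiv.symm_apply_eq]; rfl
    simp [this]
  · rintro ⟨c, rfl⟩
    ext a
    simp [hfg.apply_apply_eq_zero]

lemma dualMap_surjective_of_extVan (hf : Function.Injective f) (hfg : Function.Exact f g)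
    (hg : Function.Surjective g) (hC : ExtVan R 1 C R) : Function.Surjective f.dualMap :=
  fun a => exists_extension_of_extVan hf hfg hg hC a

/-- The kernel of a surjection between totally reflexive modules is totally reflexive. -/
lemma TotRefl.left [IsNoetherianRing R] (hf : Function.Injective f) (hfg : Function.Exact f g)
    (hg : Function.Surjective g) (hB : TotRefl R B) (hC : TotRefl R C) : TotRefl R A := by
  have hfs := dualMap_surjective_of_extVan hf hfg hg (hC.ext 0)
  have hgi : Function.Injective g.dualMap := LinearMap.dualMap_injective_of_surjective hg
  have hex := dualMap_exact hfg hg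
  have hffi : Function.Injective f.dualMap.dualMap := LinearMap.dualMap_injective_of_surjective hfs
  have := hB.finite
  refine ⟨Module.Finite.of_injective f hf, ⟨?_, ?_⟩,
    fun i => extVan_left hf hfg hg (hB.ext i) (hC.ext (i + 1)), fun i => ?_⟩
  · refine Function.Injective.of_comp (f := f.dualMap.dualMap) ?_
    exact hB.bij.1.comp hf
  · intro φ
    obtain ⟨b, hb⟩ := hB.bij.2 (f.dualMap.dualMap φ)
    have hgb : g b = 0 := hC.bij.1 (by
      ext c
      have := LinearMap.congr_fun hb (g.dualMap c)
      have h0 : f.dualMap (g.dualMap c) = 0 := hex.apply_apply_eq_zero c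
      simp only [LinearMap.dualMap_apply, h0, map_zero] at this
      simpa using this)
    obtain ⟨a, rfl⟩ := (hfg b).1 hgb
    exact ⟨a, hffi hb⟩
  · cases i with
    | succ i => exact extVan_right hgi hex hfs (hC.ext_dual i) (hB.ext_dual (i + 1))
    | zero =>
      refine extVan_one_right hgi hex hfs (fun a => ?_) (hB.ext_dual 0)
      obtain ⟨c, rfl⟩ := hC.bij.2 a
      obtain ⟨b, rfl⟩ := hg c
      exact ⟨Module.Dual.eval R B b, rfl⟩

/-- An extension of totally reflexive modules is totally reflexive. -/
lemma TotRefl.middle (hf : Function.Injective f) (hfg : Function.Exact f g)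
    (hg : Function.Surjective g) (hA : TotRefl R A) (hC : TotRefl R C) : TotRefl R B := by
  have hfs := dualMap_surjective_of_extVan hf hfg hg (hC.ext 0)
  have hgi : Function.Injective g.dualMap := LinearMap.dualMap_injective_of_surjective hg
  have hex := dualMap_exact hfg hg
  have hffi : Function.Injective f.dualMap.dualMap := LinearMap.dualMap_injective_of_surjective hfs
  have := hA.finite
  have := hC.finite
  refine ⟨Module.Finite.of_exact hfg hg, ⟨?_, ?_⟩,
    fun i => extVan_middle hf hfg hg (hA.ext i) (hC.ext i),
    fun i => extVan_middle hgi hex hfs (hC.ext_dual i) (hA.ext_dual i)⟩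
  · rw [injective_iff_map_eq_zero]
    intro b hb
    have hgb : g b = 0 := hC.bij.1 (by
      rw [map_zero]
      ext c
      exact LinearMap.congr_fun hb (g.dualMap c))
    obtain ⟨a, rfl⟩ := (hfg b).1 hgb
    have : Module.Dual.eval R A a = 0 := hffi (by rw [map_zero]; exact hb)
    rw [hA.bij.1 (this.trans (map_zero _).symm), map_zero]
  · intro φ
    obtain ⟨c, hc⟩ := hC.bij.2 (g.dualMap.dualMap φ)
    obtain ⟨b, rfl⟩ := hg c
    obtain ⟨ψ, hψ⟩ := (dualMap_exact hex hfs (φ - Module.Dual.eval R B b)).1 (by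
      rw [map_sub, ← hc]
      ext
      simp)
    obtain ⟨a, rfl⟩ := hA.bij.2 ψ
    refine ⟨b + f a, ?_⟩
    rw [map_add, add_comm, ← eq_sub_iff_add_eq, ← hψ]
    rfl

lemma TotRefl.of_linearEquiv [IsNoetherianRing R] (e : A ≃ₗ[R] B) (hB : TotRefl R B) :
    TotRefl R A :=
  TotRefl.left (f := e.toLinearMap) (g := (0 : B →ₗ[R] PUnit.{u + 1})) e.injective
    (fun x => by simp [e.surjective.range_eq]) (fun _ => ⟨0, rfl⟩) hB (TotRefl.of_free PUnit)

end TotallyReflexive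

end

section

section GorensteinDimension

/-- `M` has a resolution of length `n` by totally reflexive modules, as iterated
short exact sequences. -/
def TRDim : ℕ → ModuleCat.{u} R → Prop
  | 0, M => TotRefl R M
  | n + 1, M => ∃ (K G : ModuleCat.{u} R) (f : K →ₗ[R] G) (g : G →ₗ[R] M),
      Function.Injective f ∧ Function.Exact f g ∧ Function.Surjective g ∧ TotRefl R G ∧ TRDim n K

lemma TotRefl.prod {A B : Type u} [AddCommGroup A] [AddCommGroup B] [Module R A] [Module R B]
    (hA : TotRefl R A) (hB : TotRefl R B) : TotRefl R (A × B) :=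
  TotRefl.middle LinearMap.inl_injective .inl_snd LinearMap.snd_surjective hA hB

lemma TRDim.prod {M : ModuleCat.{u} R} {n : ℕ} (h : TRDim n M) (F : Type u) [AddCommGroup F]
    [Module R F] [Module.Free R F] [Module.Finite R F] : TRDim n (ModuleCat.of R (M × F)) := by
  cases n with
  | zero => exact TotRefl.prod h (TotRefl.of_free F)
  | succ n =>
    obtain ⟨K, G, f, g, hf, hfg, hg, hG, hK⟩ := h
    refine ⟨K, ModuleCat.of R (G × F), LinearMap.inl R G F ∘ₗ f, g.prodMap LinearMap.id,
      LinearMap.inl_injective.comp hf, ?_, ?_, TotRefl.prod hG (TotRefl.of_free F), hK⟩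
    · rintro ⟨x, y⟩
      have := hfg x
      simp only [LinearMap.prodMap_apply, LinearMap.id_apply, Prod.mk_eq_zero, this,
        Set.mem_range, LinearMap.coe_comp, Function.comp_apply, LinearMap.inl_apply, Prod.mk.injEq]
      exact ⟨fun ⟨⟨a, ha⟩, hy⟩ => ⟨a, ha, hy.symm⟩, fun ⟨a, ha, hy⟩ => ⟨⟨a, ha⟩, hy.symm⟩⟩
    · rintro ⟨x, y⟩
      obtain ⟨z, rfl⟩ := hg x
      exact ⟨(z, y), rfl⟩

variable [IsNoetherianRing R]

lemma TRDim.of_linearEquiv {M M' : ModuleCat.{u} R} (e : M ≃ₗ[R] M') {n : ℕ} (h : TRDim n M) :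
    TRDim n M' := by
  cases n with
  | zero => exact TotRefl.of_linearEquiv e.symm h
  | succ n =>
    obtain ⟨K, G, f, g, hf, hfg, hg, hG, hK⟩ := h
    exact ⟨K, G, f, e.toLinearMap ∘ₗ g, hf, fun x => by simpa using hfg x,
      e.surjective.comp hg, hG, hK⟩

lemma TRDim.ker {M C : ModuleCat.{u} R} {n : ℕ} (h : TRDim n M) (hC : TotRefl R C)
    (π : M →ₗ[R] C) (hπ : Function.Surjective π) : TRDim n (ModuleCat.of R (LinearMap.ker π)) := by
  cases n with
  | zero => exact TotRefl.left Subtype.val_injective (LinearMap.exact_subtype_ker_map π) hπ h hC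
  | succ n =>
    obtain ⟨K, G, f, g, hf, hfg, hg, hG, hK⟩ := h
    refine ⟨K, ModuleCat.of R (LinearMap.ker (π ∘ₗ g)),
      f.codRestrict _ fun x => by simp [hfg.apply_apply_eq_zero],
      (g ∘ₗ (LinearMap.ker (π ∘ₗ g)).subtype).codRestrict _ fun x => x.2, ?_, ?_, ?_, ?_, hK⟩
    · intro x y hxy
      exact hf (congrArg Subtype.val hxy)
    · rintro ⟨x, hx⟩
      have := hfg x
      exact ⟨fun h0 => (this.1 (congrArg Subtype.val h0)).imp fun y hy => Subtype.ext hy,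
        fun ⟨y, hy⟩ => Subtype.ext (this.2 ⟨y, congrArg Subtype.val hy⟩)⟩
    · rintro ⟨y, hy⟩
      obtain ⟨x, rfl⟩ := hg y
      exact ⟨⟨x, hy⟩, rfl⟩
    · exact TotRefl.left Subtype.val_injective (LinearMap.exact_subtype_ker_map (π ∘ₗ g))
        (hπ.comp hg) hG hC

lemma TRDim.syzygy {M F : ModuleCat.{u} R} {n : ℕ} (h : TRDim (n + 1) M) [Module.Free R F]
    [Module.Finite R F] (π : F →ₗ[R] M) (hπ : Function.Surjective π) :
    TRDim n (ModuleCat.of R (LinearMap.ker π)) := by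
  obtain ⟨K, G, f, g, hf, hfg, hg, hG, hK⟩ := h
  obtain ⟨l, hl⟩ := Module.projective_lifting_property g π hg
  have hl' : ∀ x, g (l x) = π x := fun x => LinearMap.congr_fun hl x
  let q : ModuleCat.of R (K × F) →ₗ[R] G := f.coprod l
  have hq : Function.Surjective q := fun x => by
    obtain ⟨y, hy⟩ := hπ (g x)
    obtain ⟨z, hz⟩ := (hfg (x - l y)).1 (by rw [map_sub, hl', hy, sub_self])
    exact ⟨(z, y), by rw [LinearMap.coprod_apply, hz, sub_add_cancel]⟩
  refine TRDim.of_linearEquiv ?_ ((hK.prod F).ker hG q hq)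
  refine LinearEquiv.ofBijective ((LinearMap.snd R K F ∘ₗ (LinearMap.ker q).subtype).codRestrict
    (LinearMap.ker π) ?_) ⟨?_, ?_⟩
  · rintro ⟨⟨z, y⟩, hzy⟩
    have h1 : f z + l y = 0 := hzy
    have h2 := congrArg g h1
    rw [map_add, hfg.apply_apply_eq_zero, zero_add, hl', map_zero] at h2
    exact h2
  · rintro ⟨⟨z, y⟩, hzy⟩ ⟨⟨z', y'⟩, hzy'⟩ h
    have hy : y = y' := congrArg Subtype.val h
    subst hy
    have h1 : f z + l y = 0 := hzy
    have h2 : f z' + l y = 0 := hzy'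
    have : z = z' := hf (add_right_cancel (h1.trans h2.symm))
    subst this
    rfl
  · rintro ⟨y, hy⟩
    obtain ⟨z, hz⟩ := (hfg (-l y)).1 (by rw [map_neg, hl', show π y = 0 from hy, neg_zero])
    exact ⟨⟨(z, y), show f z + l y = 0 by rw [hz, neg_add_cancel]⟩, rfl⟩

lemma TRDim.of_isResolution {n : ℕ} : ∀ {M : ModuleCat.{u} R}
    {G : ChainComplex (ModuleCat.{u} R) ℕ} {ε : G.X 0 ⟶ M}, IsResolution G ε →
    (∀ i, i ≤ n → TotRefl R (G.X i)) → (∀ i, n < i → IsZero (G.X i)) → TRDim n M := by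
  induction n with
  | zero =>
    intro M G ε hε hG hG0
    refine TotRefl.of_linearEquiv
      (LinearEquiv.ofBijective ε.hom ⟨?_, hε.surjective⟩).symm (hG 0 le_rfl)
    rw [injective_iff_map_eq_zero]
    intro x hx
    obtain ⟨y, rfl⟩ := (hε.exact_zero x).1 hx
    rw [(hG0 1 one_pos).eq_of_src (G.d 1 0) 0]
    rfl
  | succ n ih =>
    intro M G ε hε hG hG0
    exact ⟨_, G.X 0, (LinearMap.ker ε.hom).subtype, ε.hom, Subtype.val_injective,
      LinearMap.exact_subtype_ker_map ε.hom, hε.surjective, hG 0 (Nat.zero_le _),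
      ih hε.dropZero (fun i hi => hG (i + 1) (Nat.succ_le_succ hi))
        (fun i hi => hG0 (i + 1) (Nat.succ_lt_succ hi))⟩

lemma GDimLE.trDim {M : ModuleCat.{u} R} {n : ℕ} (h : GDimLE R M n) : TRDim n M := by
  obtain ⟨G, ε, hG, hG0, hε, ⟨w, hw⟩, hex⟩ := h
  refine TRDim.of_isResolution (G := G) (ε := ε) ⟨?_, ?_, fun k => ?_⟩
    (fun i hi => (hG i hi).totRefl) hG0
  · exact (ModuleCat.epi_iff_surjective _).1 hε
  · exact (ShortComplex.ShortExact.moduleCat_exact_iff_function_exact _).1 hw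
  · have := hex (k + 1) k.succ_pos
    rw [HomologicalComplex.exactAt_iff' _ (k + 1 + 1) (k + 1) k (by simp) (by simp),
      ShortComplex.ShortExact.moduleCat_exact_iff_function_exact] at this
    exact this

end GorensteinDimension

end

section

section CompleteResolutions

/-- A totally acyclic complex `T` of finite free modules together with a comparison map to the
complex `P` in nonnegative degrees which is bijective in degrees `≥ n`. -/
structure TateData (P : ChainComplex (ModuleCat.{u} R) ℕ) (n : ℕ) where
  T : ChainComplex (ModuleCat.{u} R) ℤ
  free : ∀ i, Module.Free R (T.X i)
  finite : ∀ i, Module.Finite R (T.X i)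
  exact : ∀ i j k : ℤ, i = j + 1 → j = k + 1 → Function.Exact (T.d i j).hom (T.d j k).hom
  dual_exact : ∀ i j k : ℤ, i = j + 1 → j = k + 1 → ∀ f : T.X j →ₗ[R] R,
    f ∘ₗ (T.d i j).hom = 0 → ∃ g : T.X k →ₗ[R] R, g ∘ₗ (T.d j k).hom = f
  θ : ∀ k : ℕ, T.X (Int.ofNat k) ⟶ P.X k
  comm : ∀ k, θ (k + 1) ≫ P.d (k + 1) k = T.d (Int.ofNat (k + 1)) (Int.ofNat k) ≫ θ k
  bij : ∀ k, n ≤ k → Function.Bijective (θ k).hom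

/-- Extension along a dual-exact complex works for every finite free target. -/
lemma exists_extension_finiteFree {A B C : Type u} [AddCommGroup A] [AddCommGroup B]
    [AddCommGroup C] [Module R A] [Module R B] [Module R C] {d : A →ₗ[R] B} {d' : B →ₗ[R] C}
    (h : ∀ f : B →ₗ[R] R, f ∘ₗ d = 0 → ∃ g : C →ₗ[R] R, g ∘ₗ d' = f)
    {F : Type u} [AddCommGroup F] [Module R F] [Module.Free R F] [Module.Finite R F]
    (f : B →ₗ[R] F) (hf : f ∘ₗ d = 0) : ∃ g : C →ₗ[R] F, g ∘ₗ d' = f := by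
  classical
  let b := Module.Free.chooseBasis R F
  have h' : ∀ i, ∃ g : C →ₗ[R] R, g ∘ₗ d' = b.coord i ∘ₗ f := fun i => h _ (by
    rw [LinearMap.comp_assoc, hf, LinearMap.comp_zero])
  choose g hg using h'
  refine ⟨∑ i, (g i).smulRight (b i), ?_⟩
  ext x
  have hx : ∀ i, g i (d' x) = b.coord i (f x) := fun i => LinearMap.congr_fun (hg i) x
  simp only [LinearMap.comp_apply, LinearMap.sum_apply, LinearMap.smulRight_apply, hx]
  exact b.sum_repr (f x)

/-- The predecessor of an integer, by pattern matching. -/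
def intPred : ℤ → ℤ
  | Int.ofNat 0 => Int.negSucc 0
  | Int.ofNat (k + 1) => Int.ofNat k
  | Int.negSucc k => Int.negSucc (k + 1)

lemma intPred_eq (i : ℤ) : intPred i = i - 1 := by
  rcases i with (_ | k) | k
  · rfl
  · simp only [intPred, Int.ofNat_eq_natCast]; push_cast; ring
  · simp only [intPred, Int.negSucc_eq]; push_cast; ring

/-- The shift of a chain complex of modules by one degree. -/
def intShift (T : ChainComplex (ModuleCat.{u} R) ℤ) : ChainComplex (ModuleCat.{u} R) ℤ where
  X i := T.X (intPred i)
  d i j := T.d (intPred i) (intPred j)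
  shape i j hij := T.shape _ _ fun h => hij (by
    simp only [ComplexShape.down_Rel, intPred_eq] at h ⊢; omega)
  d_comp_d' _ _ _ _ _ := T.d_comp_d _ _ _

lemma TateData.exists_ofDropZero {P : ChainComplex (ModuleCat.{u} R) ℕ} {n : ℕ}
    (D : TateData (dropZero P) n) [Module.Free R (P.X 0)] [Module.Finite R (P.X 0)] :
    Nonempty (TateData P (n + 1)) := by
  let t₀ : D.T.X (Int.ofNat 0) ⟶ P.X 1 := D.θ 0
  let t₁ : D.T.X (Int.ofNat 1) ⟶ P.X 2 := D.θ 1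
  have hc : t₁ ≫ P.d 2 1 = D.T.d (Int.ofNat 1) (Int.ofNat 0) ≫ t₀ := D.comm 0
  have hcomm : D.T.d (Int.ofNat 1) (Int.ofNat 0) ≫ t₀ ≫ P.d 1 0 = 0 := by
    rw [← reassoc_of% hc, P.d_comp_d, comp_zero]
  obtain ⟨g, hg⟩ := exists_extension_finiteFree
    (D.dual_exact (Int.ofNat 1) (Int.ofNat 0) (Int.negSucc 0) rfl rfl)
    (t₀ ≫ P.d 1 0).hom
    (congrArg ModuleCat.Hom.hom hcomm)
  refine ⟨⟨intShift D.T, fun i => D.free _, fun i => D.finite _,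
    fun i j k hi hj => D.exact _ _ _ (by simp only [intPred_eq]; omega)
      (by simp only [intPred_eq]; omega),
    fun i j k hi hj => D.dual_exact _ _ _ (by simp only [intPred_eq]; omega)
      (by simp only [intPred_eq]; omega),
    fun k => match k with
      | 0 => ModuleCat.ofHom g
      | k + 1 => D.θ k, fun k => ?_, fun k hk => ?_⟩⟩
  · cases k with
    | zero =>
      ext1
      exact hg.symm
    | succ k => exact D.comm k
  · cases k with
    | zero => omega
    | succ k => exact D.bij k (by omega)

end CompleteResolutions

end

section

section Splice

variable {G : ModuleCat.{u} R} (P Q : ChainComplex (ModuleCat.{u} R) ℕ) (ε : P.X 0 ⟶ G)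
  (η : Q.X 0 ⟶ ModuleCat.of R (Module.Dual R G))

/-- The terms of the splice of a resolution with the dual of a resolution of the dual. -/
def spliceX : ℤ → ModuleCat.{u} R
  | Int.ofNat k => P.X k
  | Int.negSucc k => ModuleCat.of R (Module.Dual R (Q.X k))

/-- The connecting map `P₀ → G → G** → Q₀*` of the splice. -/
def spliceConn : P.X 0 →ₗ[R] Module.Dual R (Q.X 0) :=
  η.hom.dualMap ∘ₗ Module.Dual.eval R G ∘ₗ ε.hom

/-- The differentials of the splice. -/
def spliceD : ∀ i j : ℤ, spliceX P Q i ⟶ spliceX P Q j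
  | Int.ofNat a, Int.ofNat b => P.d a b
  | Int.ofNat 0, Int.negSucc 0 => ModuleCat.ofHom (spliceConn P Q ε η)
  | Int.ofNat (_ + 1), Int.negSucc _ => 0
  | Int.ofNat 0, Int.negSucc (_ + 1) => 0
  | Int.negSucc _, Int.ofNat _ => 0
  | Int.negSucc a, Int.negSucc b => ModuleCat.ofHom (Q.d b a).hom.dualMap

lemma spliceConn_apply (p : P.X 0) (q : Q.X 0) :
    spliceConn P Q ε η p q = (η.hom q : Module.Dual R G) (ε.hom p) := rfl

variable {P Q ε η}

/-- The splice of a resolution of `G` with the dual of a resolution of the dual of `G`. -/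
def splice (hP : IsResolution P ε) (hQ : IsResolution Q η) :
    ChainComplex (ModuleCat.{u} R) ℤ where
  X := spliceX P Q
  d := spliceD P Q ε η
  shape i j hij := by
    simp only [ComplexShape.down_Rel] at hij
    rcases i with (_ | a) | a <;> rcases j with (_ | b) | b
    · exact P.shape _ _ (by simp)
    · exact P.shape _ _ (by simp)
    · rcases b with _ | b
      · exact absurd rfl hij
      · rfl
    · exact P.shape _ _ fun h => hij (congrArg Int.ofNat h)
    · exact P.shape _ _ fun h => hij (congrArg Int.ofNat h)
    · rcases b with _ | b <;> rfl
    · rfl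
    · rfl
    · change ModuleCat.ofHom (Q.d b a).hom.dualMap = 0
      rw [Q.shape b a fun h => hij (by
        simp only [ComplexShape.down_Rel] at h; subst h; omega)]
      ext φ
      let ψ : Module.Dual R (Q.X a) := φ
      exact map_zero ψ
  d_comp_d' i j k hij hjk := by
    simp only [ComplexShape.down_Rel] at hij hjk
    subst hij hjk
    rcases k with k | _ | _ | k
    · exact P.d_comp_d _ _ _
    · ext p
      refine LinearMap.ext fun q => ?_
      have h0 : ε.hom ((P.d 1 0).hom p) = 0 := hP.exact_zero.apply_apply_eq_zero p
      exact (congrArg (η.hom q : Module.Dual R G) h0).trans (map_zero _)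
    · ext p
      refine LinearMap.ext fun q => ?_
      have h0 : η.hom ((Q.d 1 0).hom q) = 0 := hQ.exact_zero.apply_apply_eq_zero q
      exact congrArg (fun φ : Module.Dual R G => φ (ε.hom p)) h0
    · ext φ
      refine LinearMap.ext fun q => ?_
      have h0 : (Q.d (k + 1) k).hom ((Q.d (k + 2) (k + 1)).hom q) = 0 :=
        (hQ.exact_succ k).apply_apply_eq_zero q
      let ψ : Module.Dual R (Q.X k) := φ
      exact (congrArg ψ h0).trans (map_zero ψ)

lemma splice_exact (hG : TotRefl R G) (hP : IsResolution P ε) (hQ : IsResolution Q η)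
    (hQf : ∀ k, Module.Free R (Q.X k)) (i j k : ℤ) (hi : i = j + 1) (hj : j = k + 1) :
    Function.Exact ((splice hP hQ).d i j).hom ((splice hP hQ).d j k).hom := by
  subst hi hj
  rcases k with k | _ | _ | k
  · exact hP.exact_succ k
  · change Function.Exact (P.d 1 0).hom (spliceConn P Q ε η)
    intro p
    rw [← hP.exact_zero p]
    constructor
    · intro h
      refine hG.bij.1 ?_
      rw [map_zero]
      refine LinearMap.ext fun φ => ?_
      obtain ⟨q, rfl⟩ := hQ.surjective φ
      exact LinearMap.congr_fun h q
    · intro h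
      refine LinearMap.ext fun q => ?_
      rw [spliceConn_apply, h, map_zero]
      rfl
  · change Function.Exact (spliceConn P Q ε η) (Q.d 1 0).hom.dualMap
    intro f
    rw [dualMap_exact hQ.exact_zero hQ.surjective f]
    constructor
    · rintro ⟨φ, rfl⟩
      obtain ⟨g, rfl⟩ := hG.bij.2 φ
      obtain ⟨p, rfl⟩ := hP.surjective g
      exact ⟨p, rfl⟩
    · rintro ⟨p, rfl⟩
      exact ⟨_, rfl⟩
  · change Function.Exact (Q.d (k + 1) k).hom.dualMap (Q.d (k + 2) (k + 1)).hom.dualMap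
    have hproj : ∀ n, Projective (Q.X n) := fun n =>
      (IsProjective.iff_projective (R := R) (Q.X n)).1
        (@Module.Projective.of_free R _ _ _ _ (hQf n))
    intro f
    constructor
    · intro hf
      obtain ⟨g, hg⟩ := ((hQ.toProjectiveResolution hproj).subsingleton_ext_succ_iff
        (ModuleCat.of R R) k).1 (hG.ext_dual k) (ModuleCat.ofHom f) (by ext1; exact hf)
      exact ⟨g.hom, congrArg ModuleCat.Hom.hom hg⟩
    · rintro ⟨g, rfl⟩
      refine LinearMap.ext fun q => ?_
      have h0 : (Q.d (k + 1) k).hom ((Q.d (k + 2) (k + 1)).hom q) = 0 :=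
        (hQ.exact_succ k).apply_apply_eq_zero q
      exact (congrArg g h0).trans (map_zero _)

lemma splice_dual_exact (hG : TotRefl R G) (hP : IsResolution P ε) (hQ : IsResolution Q η)
    (hPf : ∀ k, Module.Free R (P.X k)) (hQf : ∀ k, Module.Free R (Q.X k))
    (hQfin : ∀ k, Module.Finite R (Q.X k)) (i j k : ℤ) (hi : i = j + 1) (hj : j = k + 1)
    (f : (splice hP hQ).X j →ₗ[R] R) (hf : f ∘ₗ ((splice hP hQ).d i j).hom = 0) :
    ∃ g : (splice hP hQ).X k →ₗ[R] R, g ∘ₗ ((splice hP hQ).d j k).hom = f := by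
  subst hi hj
  rcases k with k | _ | _ | k
  · have hproj : ∀ n, Projective (P.X n) := fun n =>
      (IsProjective.iff_projective (R := R) (P.X n)).1
        (@Module.Projective.of_free R _ _ _ _ (hPf n))
    obtain ⟨g, hg⟩ := ((hP.toProjectiveResolution hproj).subsingleton_ext_succ_iff
      (ModuleCat.of R R) k).1 (hG.ext k) (ModuleCat.ofHom f) (by ext1; exact hf)
    exact ⟨g.hom, congrArg ModuleCat.Hom.hom hg⟩
  · let f' : Module.Dual R (P.X 0) := f
    obtain ⟨φ, hφ⟩ := (dualMap_exact hP.exact_zero hP.surjective f').1 hf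
    obtain ⟨q, rfl⟩ := hQ.surjective φ
    exact ⟨Module.Dual.eval R (Q.X 0) q, hφ⟩
  · obtain ⟨q, hq⟩ := (Module.bijective_dual_eval R (Q.X 0)).2 f
    have h0 : η.hom q = 0 := LinearMap.ext fun g => by
      obtain ⟨p, rfl⟩ := hP.surjective g
      have := LinearMap.congr_fun hf p
      rw [← hq] at this
      exact this
    obtain ⟨q', rfl⟩ := (hQ.exact_zero q).1 h0
    exact ⟨Module.Dual.eval R (Q.X 1) q', hq⟩
  · obtain ⟨q, hq⟩ := (Module.bijective_dual_eval R (Q.X (k + 1))).2 f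
    have h0 : (Q.d (k + 1) k).hom q = 0 := (Module.bijective_dual_eval R (Q.X k)).1 (by
      rw [map_zero]
      refine LinearMap.ext fun ψ => ?_
      have := LinearMap.congr_fun hf ψ
      rw [← hq] at this
      exact this)
    obtain ⟨q', rfl⟩ := (hQ.exact_succ k q).1 h0
    exact ⟨Module.Dual.eval R (Q.X (k + 2)) q', hq⟩

/-- The complete resolution of a totally reflexive module. -/
def spliceTateData (hG : TotRefl R G) (hP : IsResolution P ε) (hQ : IsResolution Q η)
    (hPf : ∀ k, Module.Free R (P.X k)) (hPfin : ∀ k, Module.Finite R (P.X k))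
    (hQf : ∀ k, Module.Free R (Q.X k)) (hQfin : ∀ k, Module.Finite R (Q.X k)) :
    TateData P 0 where
  T := splice hP hQ
  free i := by
    rcases i with k | k
    · exact hPf k
    · exact inferInstanceAs (Module.Free R (Module.Dual R (Q.X k)))
  finite i := by
    rcases i with k | k
    · exact hPfin k
    · exact inferInstanceAs (Module.Finite R (Module.Dual R (Q.X k)))
  exact := splice_exact hG hP hQ hQf
  dual_exact := splice_dual_exact hG hP hQ hPf hQf hQfin
  θ k := 𝟙 (P.X k)
  comm k := (Category.id_comp (P.d (k + 1) k)).trans (Category.comp_id (P.d (k + 1) k)).symm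
  bij k _ := Function.bijective_id

end Splice

lemma finite_dual [IsNoetherianRing R] (M : Type u) [AddCommGroup M] [Module R M]
    [Module.Finite R M] : Module.Finite R (Module.Dual R M) := by
  obtain ⟨n, f, hf⟩ := Module.Finite.exists_fin' R M
  exact Module.Finite.of_injective f.dualMap (LinearMap.dualMap_injective_of_surjective hf)

/-- A finite free resolution of a module of finite Gorenstein dimension underlies a complete
resolution. -/
lemma TRDim.exists_tateData [IsNoetherianRing R] {n : ℕ} :
    ∀ {M : ModuleCat.{u} R} {P : ChainComplex (ModuleCat.{u} R) ℕ} {ε : P.X 0 ⟶ M},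
    TRDim n M → IsResolution P ε → (∀ k, Module.Free R (P.X k)) →
    (∀ k, Module.Finite R (P.X k)) → Nonempty (TateData P n) := by
  induction n with
  | zero =>
    intro M P ε hM hP hPf hPfin
    have hM : TotRefl R M := hM
    have := hM.finite
    obtain ⟨Q, η, hQ, hQf, hQfin⟩ := exists_finiteFree_resolution
      (ModuleCat.of R (Module.Dual R M)) (finite_dual M)
    exact ⟨spliceTateData hM hP hQ hPf hPfin hQf hQfin⟩
  | succ n ih =>
    intro M P ε hM hP hPf hPfin
    obtain ⟨D⟩ := ih (hM.syzygy ε.hom hP.surjective) hP.dropZero (fun k => hPf (k + 1))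
      (fun k => hPfin (k + 1))
    exact D.exists_ofDropZero

end

section

section Assembly

/-- The terms of the extension of a complex by zero to negative degrees. -/
def extendX (P : ChainComplex (ModuleCat.{u} R) ℕ) : ℤ → ModuleCat.{u} R
  | Int.ofNat k => P.X k
  | Int.negSucc _ => ModuleCat.of R PUnit.{u + 1}

/-- The differentials of the extension of a complex by zero to negative degrees. -/
def extendD (P : ChainComplex (ModuleCat.{u} R) ℕ) : ∀ i j : ℤ, extendX P i ⟶ extendX P j
  | Int.ofNat a, Int.ofNat b => P.d a b
  | Int.ofNat _, Int.negSucc _ => 0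
  | Int.negSucc _, _ => 0

/-- The extension of a complex by zero to negative degrees. -/
def extendInt (P : ChainComplex (ModuleCat.{u} R) ℕ) : ChainComplex (ModuleCat.{u} R) ℤ where
  X := extendX P
  d := extendD P
  shape i j hij := by
    simp only [ComplexShape.down_Rel] at hij
    rcases i with a | a <;> rcases j with b | b
    · exact P.shape _ _ fun h => hij (congrArg Int.ofNat h)
    all_goals rfl
  d_comp_d' i j k _ _ := by
    rcases i with a | a <;> rcases j with b | b <;> rcases k with c | c
    · exact P.d_comp_d _ _ _
    · exact comp_zero
    · exact zero_comp
    all_goals exact zero_comp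

variable {M : ModuleCat.{u} R} {P : ChainComplex (ModuleCat.{u} R) ℕ} {ε : P.X 0 ⟶ M} {n : ℕ}

/-- The components of the comparison map. -/
def TateData.extendθ (D : TateData P n) : ∀ i : ℤ, D.T.X i ⟶ (extendInt P).X i
  | Int.ofNat k => D.θ k
  | Int.negSucc _ => 0

/-- The complete resolution given by `TateData`. -/
def TateData.toCompleteResolution (D : TateData P n) (hP : IsResolution P ε)
    (hPf : ∀ k, Module.Free R (P.X k)) (hPfin : ∀ k, Module.Finite R (P.X k)) :
    CompleteResolution R M where
  T := D.T
  P := extendInt P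
  θ :=
    { f := D.extendθ
      comm' := by
        rintro i j hij
        simp only [ComplexShape.down_Rel] at hij
        subst hij
        rcases j with k | k
        · exact D.comm k
        · have : IsZero ((extendInt P).X (Int.negSucc k)) :=
            (ModuleCat.isZero_of_subsingleton (ModuleCat.of R PUnit.{u + 1}) :)
          exact this.eq_of_tgt _ _ }
  π := ε
  projT i := (IsProjective.iff_projective (R := R) (D.T.X i)).1
    (@Module.Projective.of_free R _ _ _ _ (D.free i))
  fgT := D.finite
  projP i := by
    rcases i with k | k
    · exact (IsProjective.iff_projective (R := R) (P.X k)).1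
        (@Module.Projective.of_free R _ _ _ _ (hPf k))
    · exact (IsProjective.iff_projective (R := R) PUnit.{u + 1}).1 inferInstance
  fgP i := by
    rcases i with k | k
    · exact hPfin k
    · exact inferInstanceAs (Module.Finite R PUnit.{u + 1})
  zeroP i hi := by
    rcases i with k | k
    · exact absurd hi (by simp)
    · exact (ModuleCat.isZero_of_subsingleton (ModuleCat.of R PUnit.{u + 1}) :)
  epiπ := (ModuleCat.epi_iff_surjective _).2 hP.surjective
  wπ := hP.comp_eq_zero
  exact0 := (ShortComplex.ShortExact.moduleCat_exact_iff_function_exact _).2 hP.exact_zero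
  exactP i hi := by
    rcases i with (_ | k) | k
    · exact absurd hi (by simp)
    · rw [HomologicalComplex.exactAt_iff' _ (Int.ofNat (k + 2)) (Int.ofNat (k + 1)) (Int.ofNat k)
          (by simp; ring) (by simp),
        ShortComplex.ShortExact.moduleCat_exact_iff_function_exact]
      exact hP.exact_succ k
    · exact absurd hi (by simp)
  exactT i := by
    rw [HomologicalComplex.exactAt_iff' _ (i + 1) i (i - 1) (by simp) (by simp),
      ShortComplex.ShortExact.moduleCat_exact_iff_function_exact]
    exact D.exact _ _ _ rfl (by ring)
  exactTdual i := by
    rw [linearYonedaObj_exactAt_iff (i := i - 1) (k := i + 1) _ _ (by simp) (by simp)]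
    intro f hf
    obtain ⟨g, hg⟩ := D.dual_exact (i + 1) i (i - 1) rfl (by ring) f.hom
      (congrArg ModuleCat.Hom.hom hf)
    exact ⟨ModuleCat.ofHom g, by ext1; exact hg⟩
  iso_eventually := ⟨n, fun i hi => by
    rcases i with k | k
    · exact (ConcreteCategory.isIso_iff_bijective (D.θ k)).2 (D.bij k (by simpa using hi))
    · exact absurd hi (by omega)⟩

open TensorProduct

lemma TateData.rTensor_exact_of_isZero (D : TateData P n) (hP : IsResolution P ε)
    (hPf : ∀ k, Module.Free R (P.X k)) (hPfin : ∀ k, Module.Finite R (P.X k))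
    {N : ModuleCat.{u} R} {i j k : ℤ} (hi : i = j + 1) (hj : j = k + 1)
    (h : IsZero (TateTor R (D.toCompleteResolution hP hPf hPfin) N j)) :
    Function.Exact ((D.T.d i j).hom.rTensor N) ((D.T.d j k).hom.rTensor N) := by
  unfold TateTor at h
  rw [← HomologicalComplex.exactAt_iff_isZero_homology,
    HomologicalComplex.exactAt_iff' _ i j k (by simp [hi]) (by simp [hj]),
    ShortComplex.ShortExact.moduleCat_exact_iff_function_exact] at h
  exact h

end Assembly

end

section

open TensorProduct

section Balance

/-- Exactness at the middle term of a degreewise short exact sequence of three-term pieces. -/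
lemma exact_of_shift_left {A₁ A₂ B₁ B₂ B₃ C₂ C₃ A₀ : Type*}
    [AddCommGroup A₀] [AddCommGroup A₁] [AddCommGroup A₂] [AddCommGroup B₁] [AddCommGroup B₂]
    [AddCommGroup B₃] [AddCommGroup C₂] [AddCommGroup C₃]
    [Module R A₀] [Module R A₁] [Module R A₂] [Module R B₁] [Module R B₂] [Module R B₃]
    [Module R C₂] [Module R C₃] {B₀ C₁ : Type*} [AddCommGroup B₀] [Module R B₀]
    [AddCommGroup C₁] [Module R C₁]
    {a₁ : A₁ →ₗ[R] A₀} {a₂ : A₂ →ₗ[R] A₁} {b₁ : B₁ →ₗ[R] B₀} {b₂ : B₂ →ₗ[R] B₁}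
    {b₃ : B₃ →ₗ[R] B₂} {c₂ : C₂ →ₗ[R] C₁} {c₃ : C₃ →ₗ[R] C₂}
    {f₀ : A₀ →ₗ[R] B₀} {f₁ : A₁ →ₗ[R] B₁} {f₂ : A₂ →ₗ[R] B₂}
    {p₁ : B₁ →ₗ[R] C₁} {p₂ : B₂ →ₗ[R] C₂} {p₃ : B₃ →ₗ[R] C₃}
    (hf₀ : Function.Injective f₀) (hf₁ : Function.Injective f₁)
    (hfp₁ : Function.Exact f₁ p₁) (hfp₂ : Function.Exact f₂ p₂)
    (hp₂ : Function.Surjective p₂) (hp₃ : Function.Surjective p₃)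
    (ha : ∀ x, a₁ (a₂ x) = 0) (hc : ∀ x, c₂ (c₃ x) = 0)
    (hb₁ : Function.Exact b₂ b₁) (hb₂ : Function.Exact b₃ b₂)
    (e₁ : ∀ x, b₁ (f₁ x) = f₀ (a₁ x)) (e₂ : ∀ x, b₂ (f₂ x) = f₁ (a₂ x))
    (g₂ : ∀ x, c₂ (p₂ x) = p₁ (b₂ x)) (g₃ : ∀ x, c₃ (p₃ x) = p₂ (b₃ x)) :
    Function.Exact a₂ a₁ ↔ Function.Exact c₃ c₂ := by
  constructor
  · intro h z
    refine ⟨fun hz => ?_, fun ⟨y, hy⟩ => hy ▸ hc y⟩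
    obtain ⟨w, rfl⟩ := hp₂ z
    rw [g₂] at hz
    obtain ⟨u, hu⟩ := (hfp₁ _).1 hz
    have hu0 : a₁ u = 0 := hf₀ (by rw [← e₁, hu, map_zero]; exact hb₁.apply_apply_eq_zero w)
    obtain ⟨v, rfl⟩ := (h u).1 hu0
    obtain ⟨y, hy⟩ := (hb₂ (w - f₂ v)).1 (by rw [map_sub, e₂, hu, sub_self])
    exact ⟨p₃ y, by rw [g₃, hy, map_sub, hfp₂.apply_apply_eq_zero, sub_zero]⟩
  · intro h u
    refine ⟨fun hu => ?_, fun ⟨y, hy⟩ => hy ▸ ha y⟩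
    obtain ⟨w, hw⟩ := (hb₁ (f₁ u)).1 (by rw [e₁, hu, map_zero])
    obtain ⟨y, hy⟩ := (h (p₂ w)).1 (by rw [g₂, hw, hfp₁.apply_apply_eq_zero])
    obtain ⟨y, rfl⟩ := hp₃ y
    obtain ⟨v, hv⟩ := (hfp₂ (w - b₃ y)).1 (by rw [map_sub, ← g₃, hy, sub_self])
    exact ⟨v, hf₁ (by rw [← e₂, hv, map_sub, hw, hb₂.apply_apply_eq_zero, sub_zero])⟩

variable {A B K F M L Q N : Type*} [AddCommGroup A] [Module R A] [AddCommGroup B] [Module R B]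
  [AddCommGroup K] [Module R K] [AddCommGroup F] [Module R F] [AddCommGroup M] [Module R M]
  [AddCommGroup L] [Module R L] [AddCommGroup Q] [Module R Q] [AddCommGroup N] [Module R N]

lemma exact_comp_iff_injective {a : A →ₗ[R] B} {b : B →ₗ[R] K} {f : K →ₗ[R] F}
    (hab : Function.Exact a b) (hb : Function.Surjective b) :
    Function.Exact a (f ∘ₗ b) ↔ Function.Injective f := by
  constructor
  · intro h
    rw [injective_iff_map_eq_zero]
    intro x hx
    obtain ⟨y, rfl⟩ := hb x
    obtain ⟨z, rfl⟩ := (h y).1 hx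
    exact hab.apply_apply_eq_zero z
  · intro h y
    rw [← hab y, LinearMap.comp_apply, map_eq_zero_iff f h]

lemma injective_lTensor_of_injective_rTensor [Module.Flat R F]
    {f : K →ₗ[R] F} {p : F →ₗ[R] M} {g : L →ₗ[R] Q} {q : Q →ₗ[R] N}
    (hfp : Function.Exact f p) (hp : Function.Surjective p)
    (hg : Function.Injective g) (hgq : Function.Exact g q) (hq : Function.Surjective q)
    (h : Function.Injective (f.rTensor N)) : Function.Injective (g.lTensor M) := by
  rw [injective_iff_map_eq_zero]
  intro z hz
  obtain ⟨w, rfl⟩ := LinearMap.rTensor_surjective L hp z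
  rw [← LinearMap.comp_apply, LinearMap.lTensor_comp_rTensor, ← LinearMap.rTensor_comp_lTensor,
    LinearMap.comp_apply] at hz
  obtain ⟨v, hv⟩ := (rTensor_exact Q hfp hp _).1 hz
  have hv0 : q.lTensor K v = 0 := by
    apply h
    rw [map_zero, ← LinearMap.comp_apply, LinearMap.rTensor_comp_lTensor,
      ← LinearMap.lTensor_comp_rTensor, LinearMap.comp_apply, hv]
    exact (lTensor_exact F hgq hq).apply_apply_eq_zero w
  obtain ⟨t, rfl⟩ := (lTensor_exact K hgq hq _).1 hv0
  have : f.rTensor L t = w := by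
    apply Module.Flat.lTensor_preserves_injective_linearMap (M := F) g hg
    rw [← hv, ← LinearMap.comp_apply, LinearMap.lTensor_comp_rTensor,
      ← LinearMap.rTensor_comp_lTensor, LinearMap.comp_apply]
  rw [← this]
  exact (rTensor_exact L hfp hp).apply_apply_eq_zero t

lemma injective_rTensor_iff_injective_lTensor [Module.Flat R F] [Module.Flat R Q]
    {f : K →ₗ[R] F} {p : F →ₗ[R] M} {g : L →ₗ[R] Q} {q : Q →ₗ[R] N}
    (hf : Function.Injective f) (hfp : Function.Exact f p) (hp : Function.Surjective p)
    (hg : Function.Injective g) (hgq : Function.Exact g q) (hq : Function.Surjective q) :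
    Function.Injective (f.rTensor N) ↔ Function.Injective (g.lTensor M) := by
  refine ⟨injective_lTensor_of_injective_rTensor hfp hp hg hgq hq, fun h => ?_⟩
  rw [← LinearMap.lTensor_inj_iff_rTensor_inj]
  rw [LinearMap.lTensor_inj_iff_rTensor_inj] at h
  exact injective_lTensor_of_injective_rTensor hgq hq hf hfp hp h

end Balance

end

section

open TensorProduct

section Tor

variable {M N : ModuleCat.{u} R} {P Q : ChainComplex (ModuleCat.{u} R) ℕ} {ε : P.X 0 ⟶ M}
  {η : Q.X 0 ⟶ N}

lemma IsResolution.rTensor_exact_one_iff (h : IsResolution P ε) (Y : Type u) [AddCommGroup Y]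
    [Module R Y] :
    Function.Exact ((P.d 2 1).hom.rTensor Y) ((P.d 1 0).hom.rTensor Y) ↔
      Function.Injective ((LinearMap.ker ε.hom).subtype.rTensor Y) := by
  have e : (P.d 1 0).hom.rTensor Y =
      (LinearMap.ker ε.hom).subtype.rTensor Y ∘ₗ h.syzygyMap.hom.rTensor Y := by
    rw [← LinearMap.rTensor_comp]
    rfl
  rw [e]
  exact exact_comp_iff_injective (rTensor_exact Y h.dropZero.exact_zero h.dropZero.surjective)
    (LinearMap.rTensor_surjective Y h.dropZero.surjective)

lemma IsResolution.lTensor_exact_one_iff (h : IsResolution P ε) (Y : Type u) [AddCommGroup Y]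
    [Module R Y] :
    Function.Exact ((P.d 2 1).hom.lTensor Y) ((P.d 1 0).hom.lTensor Y) ↔
      Function.Injective ((LinearMap.ker ε.hom).subtype.lTensor Y) := by
  have e : (P.d 1 0).hom.lTensor Y =
      (LinearMap.ker ε.hom).subtype.lTensor Y ∘ₗ h.syzygyMap.hom.lTensor Y := by
    rw [← LinearMap.lTensor_comp]
    rfl
  rw [e]
  exact exact_comp_iff_injective (lTensor_exact Y h.dropZero.exact_zero h.dropZero.surjective)
    (LinearMap.lTensor_surjective Y h.dropZero.surjective)

lemma IsResolution.rTensor_exact_iff_lTensor_exact (hP : IsResolution P ε)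
    (hQ : IsResolution Q η) (hPf : ∀ k, Module.Flat R (P.X k)) (hQf : ∀ k, Module.Flat R (Q.X k))
    (i : ℕ) :
    Function.Exact ((P.d (i + 2) (i + 1)).hom.rTensor N) ((P.d (i + 1) i).hom.rTensor N) ↔
      Function.Exact ((Q.d (i + 2) (i + 1)).hom.lTensor M) ((Q.d (i + 1) i).hom.lTensor M) := by
  have := hPf 0
  have := hQf 0
  induction i generalizing M P with
  | zero =>
    rw [hP.rTensor_exact_one_iff N, hQ.lTensor_exact_one_iff M]
    exact injective_rTensor_iff_injective_lTensor Subtype.val_injective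
      (LinearMap.exact_subtype_ker_map ε.hom) hP.surjective Subtype.val_injective
      (LinearMap.exact_subtype_ker_map η.hom) hQ.surjective
  | succ i ih =>
    refine (ih hP.dropZero (fun k => hPf (k + 1)) (hPf 1)).trans ?_
    have hF := hPf 0
    have hS := LinearMap.exact_subtype_ker_map ε.hom
    have hI : Function.Injective (LinearMap.ker ε.hom).subtype := Subtype.val_injective
    have hcomm : ∀ {A B C D : Type u} [AddCommGroup A] [AddCommGroup B] [AddCommGroup C]
        [AddCommGroup D] [Module R A] [Module R B] [Module R C] [Module R D]
        (f : A →ₗ[R] B) (g : C →ₗ[R] D) (x : A ⊗[R] C),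
        g.lTensor B (f.rTensor C x) = f.rTensor D (g.lTensor A x) := by
      intro A B C D _ _ _ _ _ _ _ _ f g x
      rw [← LinearMap.comp_apply, LinearMap.lTensor_comp_rTensor,
        ← LinearMap.rTensor_comp_lTensor, LinearMap.comp_apply]
    have hd : ∀ (Y : Type u) [AddCommGroup Y] [Module R Y] (k : ℕ) (x : Y ⊗[R] (Q.X (k + 2))),
        (Q.d (k + 1) k).hom.lTensor Y ((Q.d (k + 2) (k + 1)).hom.lTensor Y x) = 0 := by
      intro Y _ _ k x
      rw [← LinearMap.comp_apply, ← LinearMap.lTensor_comp,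
        (hQ.exact_succ k).linearMap_comp_eq_zero]
      simp
    have hQ0 := hQf i
    have hQ1 := hQf (i + 1)
    exact exact_of_shift_left
      (f₀ := (LinearMap.ker ε.hom).subtype.rTensor (Q.X i))
      (f₁ := (LinearMap.ker ε.hom).subtype.rTensor (Q.X (i + 1)))
      (f₂ := (LinearMap.ker ε.hom).subtype.rTensor (Q.X (i + 2)))
      (p₁ := ε.hom.rTensor (Q.X (i + 1)))
      (p₂ := ε.hom.rTensor (Q.X (i + 2))) (p₃ := ε.hom.rTensor (Q.X (i + 3)))
      (b₁ := (Q.d (i + 1) i).hom.lTensor (P.X 0))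
      (b₂ := (Q.d (i + 2) (i + 1)).hom.lTensor (P.X 0))
      (b₃ := (Q.d (i + 3) (i + 2)).hom.lTensor (P.X 0))
      (Module.Flat.rTensor_preserves_injective_linearMap _ hI)
      (Module.Flat.rTensor_preserves_injective_linearMap _ hI)
      (rTensor_exact _ hS hP.surjective) (rTensor_exact _ hS hP.surjective)
      (LinearMap.rTensor_surjective _ hP.surjective)
      (LinearMap.rTensor_surjective _ hP.surjective)
      (hd _ i) (hd _ (i + 1))
      (Module.Flat.lTensor_exact _ (hQ.exact_succ i))
      (Module.Flat.lTensor_exact _ (hQ.exact_succ (i + 1)))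
      (hcomm _ _) (hcomm _ _) (hcomm _ _) (hcomm _ _)

lemma isZero_torMod_succ_iff_lTensor (Q : ProjectiveResolution N) (M : ModuleCat.{u} R) (i : ℕ) :
    IsZero (TorMod R (i + 1) M N) ↔
      Function.Exact ((Q.complex.d (i + 2) (i + 1)).hom.lTensor M)
        ((Q.complex.d (i + 1) i).hom.lTensor M) := by
  have e := Q.isoLeftDerivedObj ((tensoringLeft (ModuleCat.{u} R)).obj M) (i + 1)
  have e' : IsZero (TorMod R (i + 1) M N) ↔ IsZero (HomologicalComplex.homology
    ((((tensoringLeft (ModuleCat.{u} R)).obj M).mapHomologicalComplex _).obj Q.complex) (i + 1)) :=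
    e.isZero_iff
  rw [e', ← HomologicalComplex.exactAt_iff_isZero_homology,
    HomologicalComplex.exactAt_iff' _ (i + 2) (i + 1) i (by simp) (by simp),
    ShortComplex.ShortExact.moduleCat_exact_iff_function_exact]
  rfl

lemma IsResolution.isZero_torMod_succ_iff (hP : IsResolution P ε)
    (hPf : ∀ k, Module.Free R (P.X k)) (N : ModuleCat.{u} R) (i : ℕ) :
    IsZero (TorMod R (i + 1) M N) ↔
      Function.Exact ((P.d (i + 2) (i + 1)).hom.rTensor N) ((P.d (i + 1) i).hom.rTensor N) := by
  obtain ⟨Q⟩ := (inferInstance : HasProjectiveResolution N).out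
  refine (isZero_torMod_succ_iff_lTensor Q M i).trans
    (hP.rTensor_exact_iff_lTensor_exact (N := N) (η := Q.π.f 0) Q.isResolution
    (fun k => have := hPf k; inferInstance) (fun k => ?_) i).symm
  have : Module.Projective R (Q.complex.X k) :=
    (IsProjective.iff_projective (R := R) (Q.complex.X k)).2 (Q.projective k)
  infer_instance

lemma nontrivial_tensorProduct_of_isLocalRing [IsLocalRing R] (M N : Type*) [AddCommGroup M]
    [Module R M] [Module.Finite R M] [Nontrivial M] [AddCommGroup N] [Module R N]
    [Module.Finite R N] [Nontrivial N] : Nontrivial (M ⊗[R] N) := by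
  by_contra hc
  rw [not_nontrivial_iff_subsingleton] at hc
  let k := IsLocalRing.ResidueField R
  have hkM : Nontrivial (k ⊗[R] M) := by
    rw [← not_subsingleton_iff_nontrivial, IsLocalRing.subsingleton_tensorProduct,
      not_subsingleton_iff_nontrivial]
    infer_instance
  obtain ⟨v, hv⟩ := exists_ne (0 : k ⊗[R] M)
  obtain ⟨φ, hφ⟩ := Module.Projective.exists_dual_eq_one k hv
  let ψ : M →ₗ[R] k := (φ.restrictScalars R) ∘ₗ TensorProduct.mk R k M 1
  have hψ : ∃ m, ψ m ≠ 0 := by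
    by_contra! h
    have h0 : φ = 0 := by
      ext m
      exact h m
    simp [h0] at hφ
  obtain ⟨m, hm⟩ := hψ
  have hsurj : Function.Surjective ψ := by
    intro c
    obtain ⟨r, hr⟩ := IsLocalRing.residue_surjective (c / ψ m)
    refine ⟨r • m, ?_⟩
    rw [map_smul, Algebra.smul_def, IsLocalRing.ResidueField.algebraMap_eq, hr,
      div_mul_cancel₀ _ hm]
  have : Subsingleton (k ⊗[R] N) := (LinearMap.rTensor_surjective N hsurj).subsingleton
  rw [IsLocalRing.subsingleton_tensorProduct] at this
  exact not_subsingleton N this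

lemma not_isZero_torMod_zero [IsLocalRing R] (M N : Type u) [AddCommGroup M] [Module R M]
    [Module.Finite R M] [Nontrivial M] [AddCommGroup N] [Module R N] [Module.Finite R N]
    [Nontrivial N] : ¬ IsZero (TorMod R 0 (ModuleCat.of R M) (ModuleCat.of R N)) := by
  intro h
  have e := ((tensoringLeft (ModuleCat.{u} R)).obj
    (ModuleCat.of R M)).leftDerivedZeroIsoSelf.app (ModuleCat.of R N)
  have h' := (e.isZero_iff).1 h
  have : Subsingleton (M ⊗[R] N) := ModuleCat.subsingleton_of_isZero h'
  exact not_subsingleton_iff_nontrivial.2 (nontrivial_tensorProduct_of_isLocalRing M N) this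

end Tor

end

section

open TensorProduct

section TensorExact

variable {F₃ F₂ F₁ F₀ : Type*} [AddCommGroup F₃] [AddCommGroup F₂] [AddCommGroup F₁]
  [AddCommGroup F₀] [Module R F₃] [Module R F₂] [Module R F₁] [Module R F₀]

/-- Every element of the kernel of `b ⊗ N` lies in the image of `a ⊗ N`. -/
def TensorExact (a : F₃ →ₗ[R] F₂) (b : F₂ →ₗ[R] F₁) (N : Type*) [AddCommGroup N] [Module R N] :
    Prop :=
  ∀ z, b.rTensor N z = 0 → ∃ w, a.rTensor N w = z

variable {N : Type*} [AddCommGroup N] [Module R N]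

lemma rTensor_apply_apply (a : F₃ →ₗ[R] F₂) (b : F₂ →ₗ[R] F₁) (z : F₃ ⊗[R] N) :
    b.rTensor N (a.rTensor N z) = (b ∘ₗ a).rTensor N z := by
  rw [LinearMap.rTensor_comp, LinearMap.comp_apply]

lemma rTensor_bijective {a : F₃ →ₗ[R] F₂} (ha : Function.Bijective a) (N : Type*)
    [AddCommGroup N] [Module R N] : Function.Bijective (a.rTensor N) :=
  ((LinearEquiv.ofBijective a ha).rTensor N).bijective

variable {N' : Type*} [AddCommGroup N'] [Module R N'] {q : N →ₗ[R] N'} {x : R}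

lemma lTensor_exact_smul (F : Type*) [AddCommGroup F] [Module R F]
    (hq : Function.Exact (LinearMap.lsmul R N x) q) (hqs : Function.Surjective q) :
    Function.Exact (LinearMap.lsmul R (F ⊗[R] N) x) (q.lTensor F) := by
  have h := lTensor_exact F hq hqs
  have e : (LinearMap.lsmul R N x).lTensor F = LinearMap.lsmul R (F ⊗[R] N) x := by
    ext
    simp
  rwa [e] at h

lemma lTensor_rTensor_apply {A B C D : Type*} [AddCommGroup A] [AddCommGroup B] [AddCommGroup C]
    [AddCommGroup D] [Module R A] [Module R B] [Module R C] [Module R D]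
    (f : A →ₗ[R] B) (g : C →ₗ[R] D) (x : A ⊗[R] C) :
    g.lTensor B (f.rTensor C x) = f.rTensor D (g.lTensor A x) := by
  rw [← LinearMap.comp_apply, LinearMap.lTensor_comp_rTensor,
    ← LinearMap.rTensor_comp_lTensor, LinearMap.comp_apply]

variable {a₃ : F₃ →ₗ[R] F₂} {a₂ : F₂ →ₗ[R] F₁} {a₁ : F₁ →ₗ[R] F₀}

lemma TensorExact.of_exact_smul [Module.Flat R F₀] (hx : IsSMulRegular N x)
    (hq : Function.Exact (LinearMap.lsmul R N x) q) (hqs : Function.Surjective q)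
    (h₂ : TensorExact a₃ a₂ N) (h₁ : TensorExact a₂ a₁ N) (h : a₁ ∘ₗ a₂ = 0) :
    TensorExact a₃ a₂ N' := by
  intro z hz
  obtain ⟨z, rfl⟩ := LinearMap.lTensor_surjective F₂ hqs z
  rw [← lTensor_rTensor_apply] at hz
  obtain ⟨t, ht : x • t = _⟩ := (lTensor_exact_smul F₁ hq hqs _).1 hz
  have ht0 : a₁.rTensor N t = 0 := by
    apply hx.lTensor F₀
    change x • a₁.rTensor N t = x • 0
    rw [← map_smul, ht, rTensor_apply_apply, h, LinearMap.rTensor_zero, smul_zero]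
    rfl
  obtain ⟨v, rfl⟩ := h₁ t ht0
  obtain ⟨y, hy⟩ := h₂ (z - x • v) (by rw [map_sub, map_smul, ht, sub_self])
  refine ⟨q.lTensor F₃ y, ?_⟩
  have := (lTensor_exact_smul F₂ hq hqs).apply_apply_eq_zero v
  rw [LinearMap.lsmul_apply] at this
  rw [← lTensor_rTensor_apply, hy, map_sub, this, sub_zero]

lemma TensorExact.descend_of_exact_smul [Module.Flat R F₁] (hx : IsSMulRegular N x)
    (hq : Function.Exact (LinearMap.lsmul R N x) q) (hqs : Function.Surjective q)
    (h : TensorExact a₃ a₂ N') (h₀ : a₂ ∘ₗ a₃ = 0)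
    (hkill : ∀ z, a₁.rTensor N z = 0 → ∃ w, a₂.rTensor N w = x • z) : TensorExact a₂ a₁ N := by
  intro z hz
  obtain ⟨w, hw⟩ := hkill z hz
  obtain ⟨y, hy⟩ := h (q.lTensor F₂ w) (by
    have := (lTensor_exact_smul F₁ hq hqs).apply_apply_eq_zero z
    rw [LinearMap.lsmul_apply] at this
    rw [← lTensor_rTensor_apply, hw, this])
  obtain ⟨y, rfl⟩ := LinearMap.lTensor_surjective F₃ hqs y
  obtain ⟨v, hv : x • v = _⟩ := (lTensor_exact_smul F₂ hq hqs (w - a₃.rTensor N y)).1 (by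
    rw [map_sub, lTensor_rTensor_apply, hy, sub_self])
  refine ⟨v, hx.lTensor F₁ ?_⟩
  change x • a₂.rTensor N v = x • z
  rw [← map_smul, hv, map_sub, hw, rTensor_apply_apply, h₀, LinearMap.rTensor_zero,
    LinearMap.zero_apply, sub_zero]

end TensorExact

section Annihilator

variable {M : ModuleCat.{u} R} {P : ChainComplex (ModuleCat.{u} R) ℕ} {ε : P.X 0 ⟶ M}

lemma IsResolution.exists_homotopy_smul (hP : IsResolution P ε)
    (hproj : ∀ n, Projective (P.X n)) {x : R} (hx : x ∈ Module.annihilator R M) (i : ℕ) :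
    ∃ (f : P.X i →ₗ[R] P.X (i + 1)) (g : P.X (i - 1) →ₗ[R] P.X i),
      (P.d (i + 1) i).hom ∘ₗ f + g ∘ₗ (P.d i (i - 1)).hom = x • LinearMap.id := by
  let Q := hP.toProjectiveResolution hproj
  have hε : x • ε = 0 := by
    ext y
    exact Module.mem_annihilator.1 hx _
  have hcomm : (x • 𝟙 Q.complex) ≫ Q.π = 0 := by
    apply HomologicalComplex.to_single_hom_ext
    rw [Linear.smul_comp, Category.id_comp]
    have e : Q.π.f 0 = ε := by
      simp [Q, IsResolution.toProjectiveResolution]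
    rw [HomologicalComplex.smul_f_apply]
    exact (congrArg (x • ·) e).trans hε
  let H := ProjectiveResolution.liftHomotopyZero (x • 𝟙 Q.complex) hcomm
  have hH := H.comm i
  cases i with
  | zero =>
    rw [Homotopy.dNext_zero_chainComplex, Homotopy.prevD_chainComplex] at hH
    refine ⟨(H.hom 0 1).hom, 0, LinearMap.ext fun y => ?_⟩
    have := LinearMap.congr_fun (congrArg ModuleCat.Hom.hom hH) y
    simp only [zero_add, HomologicalComplex.zero_f, add_zero] at this
    simp only [LinearMap.zero_comp, add_zero]
    exact this.symm
  | succ i =>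
    rw [Homotopy.dNext_succ_chainComplex, Homotopy.prevD_chainComplex] at hH
    refine ⟨(H.hom (i + 1) (i + 2)).hom, (H.hom i (i + 1)).hom, LinearMap.ext fun y => ?_⟩
    have := LinearMap.congr_fun (congrArg ModuleCat.Hom.hom hH) y
    simp only [HomologicalComplex.zero_f, add_zero] at this
    exact (add_comm _ _).trans this.symm

lemma IsResolution.exists_rTensor_eq_smul (hP : IsResolution P ε)
    (hproj : ∀ n, Projective (P.X n)) {x : R} (hx : x ∈ Module.annihilator R M) (i : ℕ)
    (N : Type*) [AddCommGroup N] [Module R N] {z : P.X i ⊗[R] N}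
    (hz : (P.d i (i - 1)).hom.rTensor N z = 0) :
    ∃ w, (P.d (i + 1) i).hom.rTensor N w = x • z := by
  obtain ⟨f, g, hfg⟩ := hP.exists_homotopy_smul hproj hx i
  refine ⟨f.rTensor N z, ?_⟩
  have := LinearMap.congr_fun (congrArg (LinearMap.rTensor N) hfg) z
  rwa [LinearMap.rTensor_add, LinearMap.add_apply, ← rTensor_apply_apply, ← rTensor_apply_apply, hz,
    map_zero, add_zero, LinearMap.rTensor_smul, LinearMap.rTensor_id] at this

end Annihilator

end

section

open TensorProduct

section ExtQuotient

variable {M N N' : Type u} [AddCommGroup M] [AddCommGroup N] [AddCommGroup N'] [Module R M]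
  [Module R N] [Module R N'] {x : R} {q : N →ₗ[R] N'}

lemma extVan_zero_iff : ExtVan R 0 M N ↔ Subsingleton (M →ₗ[R] N) :=
  (Abelian.Ext.addEquiv₀.trans ModuleCat.homAddEquiv).toEquiv.subsingleton_congr

lemma extVan_of_exact_smul (hx : IsSMulRegular N x)
    (hq : Function.Exact (LinearMap.lsmul R N x) q) (hqs : Function.Surjective q) {i : ℕ}
    (h₀ : ExtVan R i M N) (h₁ : ExtVan R (i + 1) M N) : ExtVan R i M N' := by
  refine subsingleton_of_forall_eq 0 fun e => ?_
  obtain ⟨y, rfl⟩ := Abelian.Ext.covariant_sequence_exact₃ (ModuleCat.of R M)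
    (shortExact_of_linearMap (f := LinearMap.lsmul R N x) hx hq hqs) e rfl
    (Subsingleton.elim (h := h₁) _ _)
  rw [Subsingleton.elim (h := h₀) y 0, Abelian.Ext.zero_comp]

lemma ext_smul_eq_zero_of_mem_annihilator (hM : x ∈ Module.annihilator R M) {i : ℕ}
    (e : Abelian.Ext.{u} (ModuleCat.of R M) (ModuleCat.of R N) i) : x • e = 0 := by
  have : x • 𝟙 (ModuleCat.of R M) = 0 := by
    ext m
    exact Module.mem_annihilator.1 hM m
  have h : x • e = (Abelian.Ext.mk₀ (x • 𝟙 (ModuleCat.of R M))).comp e (zero_add i) := by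
    simp [Abelian.Ext.mk₀_smul]
  rw [h, this, Abelian.Ext.mk₀_zero, Abelian.Ext.zero_comp]

lemma extVan_succ_of_exact_smul (hx : IsSMulRegular N x) (hM : x ∈ Module.annihilator R M)
    (hq : Function.Exact (LinearMap.lsmul R N x) q) (hqs : Function.Surjective q) {i : ℕ}
    (h : ExtVan R i M N') : ExtVan R (i + 1) M N := by
  refine subsingleton_of_forall_eq 0 fun e => ?_
  have he := ext_smul_eq_zero_of_mem_annihilator hM e
  rw [Abelian.Ext.smul_eq_comp_mk₀] at he
  obtain ⟨y, rfl⟩ := Abelian.Ext.covariant_sequence_exact₁ (ModuleCat.of R M)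
    (shortExact_of_linearMap (f := LinearMap.lsmul R N x) hx hq hqs) e he rfl
  rw [Subsingleton.elim (h := h) y 0, Abelian.Ext.zero_comp]

end ExtQuotient

section DualTensor

variable {F G N : Type*} [AddCommGroup F] [AddCommGroup G] [AddCommGroup N] [Module R F]
  [Module R G] [Module R N]

/-- The evaluation map `F ⊗ N → Hom(F^*, N)`. -/
def tensorToDualHom (F N : Type*) [AddCommGroup F] [AddCommGroup N] [Module R F] [Module R N] :
    F ⊗[R] N →ₗ[R] Module.Dual R F →ₗ[R] N :=
  dualTensorHom R (Module.Dual R F) N ∘ₗ (Module.Dual.eval R F).rTensor N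

lemma tensorToDualHom_rTensor (f : F →ₗ[R] G) (z : F ⊗[R] N) (a : Module.Dual R G) :
    tensorToDualHom G N (f.rTensor N z) a = tensorToDualHom F N z (a ∘ₗ f) := by
  induction z with
  | zero => simp
  | add y z hy hz => simp only [map_add, LinearMap.add_apply, hy, hz]
  | tmul y z => simp [tensorToDualHom, dualTensorHom_apply]

lemma tensorToDualHom_bijective [Module.Free R F] [Module.Finite R F] :
    Function.Bijective (tensorToDualHom (R := R) F N) := by
  have h : Function.Bijective ((Module.Dual.eval R F).rTensor N) :=
    rTensor_bijective (Module.bijective_dual_eval R F) N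
  have h' : Function.Bijective (dualTensorHom R (Module.Dual R F) N) :=
    (dualTensorHomEquiv R (Module.Dual R F) N).bijective
  exact h'.comp h

/-- If no nonzero element of `F ⊗ N` is killed by both `f ⊗ N` and `g ⊗ N`, then some `N`-regular
element `s` satisfies `s F^* ⊆ im f^* + im g^*`. -/
lemma exists_isSMulRegular_smul_dual [IsNoetherianRing R] {G' : Type*} [AddCommGroup G']
    [Module R G'] [Module.Free R F] [Module.Finite R F] [Module.Free R G] [Module.Finite R G]
    [Module.Free R G'] [Module.Finite R G'] [Module.Finite R N] (f : F →ₗ[R] G) (g : F →ₗ[R] G')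
    (h : ∀ z : F ⊗[R] N, f.rTensor N z = 0 → g.rTensor N z = 0 → z = 0) :
    ∃ s : R, IsSMulRegular N s ∧ ∀ c : Module.Dual R F, ∃ (a : Module.Dual R G)
      (b : Module.Dual R G'), a ∘ₗ f + b ∘ₗ g = s • c := by
  let S : Submodule R (Module.Dual R F) := LinearMap.range f.dualMap ⊔ LinearMap.range g.dualMap
  have hsub : Subsingleton ((Module.Dual R F ⧸ S) →ₗ[R] N) := by
    refine subsingleton_of_forall_eq 0 fun φ => ?_
    obtain ⟨z, hz⟩ := (tensorToDualHom_bijective (R := R) (F := F) (N := N)).2 (φ ∘ₗ S.mkQ)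
    have hker : ∀ c ∈ S, tensorToDualHom F N z c = 0 := fun c hc => by
      rw [hz, LinearMap.comp_apply, Submodule.mkQ_apply, (Submodule.Quotient.mk_eq_zero S).2 hc,
        map_zero]
    have hz0 : z = 0 := by
      refine h z ?_ ?_
      · apply (tensorToDualHom_bijective (R := R) (F := G) (N := N)).1
        ext a
        rw [tensorToDualHom_rTensor, map_zero]
        exact hker _ (Submodule.mem_sup_left ⟨a, rfl⟩)
      · apply (tensorToDualHom_bijective (R := R) (F := G') (N := N)).1
        ext a
        rw [tensorToDualHom_rTensor, map_zero]
        exact hker _ (Submodule.mem_sup_right ⟨a, rfl⟩)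
    rw [hz0, map_zero] at hz
    exact Submodule.linearMap_qext _ (hz.symm.trans (LinearMap.zero_comp _).symm)
  obtain ⟨s, hs, hreg⟩ := IsSMulRegular.subsingleton_linearMap_iff.1 hsub
  refine ⟨s, hreg, fun c => ?_⟩
  have hc := Module.mem_annihilator.1 hs (S.mkQ c)
  rw [← map_smul, Submodule.mkQ_apply, Submodule.Quotient.mk_eq_zero] at hc
  obtain ⟨_, ⟨a, rfl⟩, _, ⟨b, rfl⟩, hab⟩ := Submodule.mem_sup.1 hc
  exact ⟨a, b, hab⟩

end DualTensor

lemma CategoryTheory.ProjectiveResolution.smul_ext_succ_eq_zero {M N : ModuleCat.{u} R}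
    (P : ProjectiveResolution M) {n : ℕ} {s : R}
    (h : ∀ f : P.complex.X (n + 1) ⟶ N, P.complex.d (n + 2) (n + 1) ≫ f = 0 →
        ∃ g : P.complex.X n ⟶ N, P.complex.d (n + 1) n ≫ g = s • f)
    (e : Abelian.Ext.{u} M N (n + 1)) : s • e = 0 := by
  obtain ⟨f, hf, rfl⟩ := P.extMk_surjective e (n + 2) rfl
  obtain ⟨g, hg⟩ := h f hf
  rw [Abelian.Ext.smul_eq_comp_mk₀, P.extMk_comp_mk₀, P.extMk_eq_zero_iff _ _ _ _ n rfl]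
  exact ⟨g, by rw [hg, Linear.comp_smul, Category.comp_id]⟩

end

section

open TensorProduct

section MainInduction

/-- The vanishing of the homology of `P ⊗ N` in degree `i`. -/
def TorVan (P : ChainComplex (ModuleCat.{u} R) ℕ) (N : Type u) [AddCommGroup N] [Module R N]
    (i : ℕ) : Prop :=
  TensorExact (P.d (i + 1) i).hom (P.d i (i - 1)).hom N

/-- The vanishing of the homology of `T ⊗ N` in degrees `≥ s`. -/
def TateVanFrom (T : ChainComplex (ModuleCat.{u} R) ℤ) (N : Type u) [AddCommGroup N] [Module R N]
    (s : ℕ) : Prop :=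
  ∀ i j k : ℤ, i = j + 1 → j = k + 1 → (s : ℤ) ≤ j → TensorExact (T.d i j).hom (T.d j k).hom N

variable {M : Type u} [AddCommGroup M] [Module R M]
  {P : ChainComplex (ModuleCat.{u} R) ℕ} {ε : P.X 0 ⟶ ModuleCat.of R M} {n : ℕ}
  {N : Type u} [AddCommGroup N] [Module R N]

lemma d_comp_d_hom {α : Type*} {c : ComplexShape α} (X : HomologicalComplex (ModuleCat.{u} R) c)
    (i j k : α) : (X.d j k).hom ∘ₗ (X.d i j).hom = 0 := by
  rw [← ModuleCat.hom_comp, X.d_comp_d, ModuleCat.hom_zero]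

lemma TateData.comm_hom (D : TateData P n) (k : ℕ) :
    (P.d (k + 1) k).hom ∘ₗ (D.θ (k + 1)).hom =
      (D.θ k).hom ∘ₗ (D.T.d (Int.ofNat (k + 1)) (Int.ofNat k)).hom :=
  congrArg ModuleCat.Hom.hom (D.comm k)

lemma TateData.rTensor_comm (D : TateData P n) (k : ℕ) (z : D.T.X (Int.ofNat (k + 1)) ⊗[R] N) :
    (P.d (k + 1) k).hom.rTensor N ((D.θ (k + 1)).hom.rTensor N z) =
      (D.θ k).hom.rTensor N ((D.T.d (Int.ofNat (k + 1)) (Int.ofNat k)).hom.rTensor N z) := by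
  rw [rTensor_apply_apply, rTensor_apply_apply, D.comm_hom]

/-- The homology of `P ⊗ N` vanishes above the bijectivity range of the comparison map. -/
lemma TateData.torVan_succ (D : TateData P n) {s k : ℕ} (h : TateVanFrom D.T N s) (hs : s ≤ k + 1)
    (hk : n ≤ k) : TorVan P N (k + 1) := by
  intro z hz
  obtain ⟨z, rfl⟩ := (rTensor_bijective (D.bij (k + 1) (by omega)) N).2 z
  have hz' := (D.rTensor_comm k z).symm.trans hz
  rw [map_eq_zero_iff _ (rTensor_bijective (D.bij k hk) N).1] at hz'
  obtain ⟨w, hw⟩ := h (Int.ofNat (k + 2)) (Int.ofNat (k + 1)) (Int.ofNat k) (by simp; ring)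
    (by simp) (by simp; omega) z hz'
  refine ⟨(D.θ (k + 2)).hom.rTensor N w, ?_⟩
  rw [D.rTensor_comm, hw]

/-- In the top degree, a regular element annihilating `M` forces the vanishing of `Tor`. -/
lemma TateData.torVan_top (D : TateData P n) (hP : IsResolution P ε)
    (hproj : ∀ k, Projective (P.X k)) (h : TateVanFrom D.T N n) {x : R}
    (hx : x ∈ Module.annihilator R M) (hreg : IsSMulRegular N x) : TorVan P N n := by
  intro z hz
  obtain ⟨w, hw⟩ := hP.exists_rTensor_eq_smul hproj hx n N hz
  obtain ⟨z, rfl⟩ := (rTensor_bijective (D.bij n le_rfl) N).2 z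
  obtain ⟨w, rfl⟩ := (rTensor_bijective (D.bij (n + 1) (by omega)) N).2 w
  rw [D.rTensor_comm, ← map_smul] at hw
  have hw' := (rTensor_bijective (D.bij n le_rfl) N).1 hw
  have := D.free (Int.ofNat n - 1)
  have hz0 : (D.T.d (Int.ofNat n) (Int.ofNat n - 1)).hom.rTensor N z = 0 := by
    apply hreg.lTensor (D.T.X (Int.ofNat n - 1))
    change x • _ = x • 0
    rw [← map_smul, ← hw', rTensor_apply_apply, d_comp_d_hom, LinearMap.rTensor_zero, smul_zero]
    rfl
  obtain ⟨v, hv⟩ := h (Int.ofNat (n + 1)) (Int.ofNat n) (Int.ofNat n - 1) (by simp)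
    (by simp) (by simp) z hz0
  exact ⟨(D.θ (n + 1)).hom.rTensor N v, by rw [D.rTensor_comm, hv]⟩

lemma TateData.eq_zero_of_rTensor_eq_zero {m : ℕ} (D : TateData P (m + 1))
    (h : TateVanFrom D.T N m) (hT : TorVan P N (m + 1)) (z : D.T.X (Int.ofNat m) ⊗[R] N)
    (hz : (D.T.d (Int.ofNat m) (Int.ofNat m - 1)).hom.rTensor N z = 0)
    (hz' : (D.θ m).hom.rTensor N z = 0) : z = 0 := by
  obtain ⟨w, rfl⟩ := h (Int.ofNat (m + 1)) (Int.ofNat m) (Int.ofNat m - 1) (by simp)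
    (by simp) (by simp) z hz
  rw [← D.rTensor_comm] at hz'
  obtain ⟨y, hy⟩ := hT _ hz'
  obtain ⟨y, rfl⟩ := (rTensor_bijective (D.bij (m + 2) (by omega)) N).2 y
  have hy' : (D.θ (m + 1)).hom.rTensor N
      ((D.T.d (Int.ofNat (m + 2)) (Int.ofNat (m + 1))).hom.rTensor N y) =
      (D.θ (m + 1)).hom.rTensor N w := (D.rTensor_comm (m + 1) y).symm.trans hy
  rw [← (rTensor_bijective (D.bij (m + 1) le_rfl) N).1 hy', rTensor_apply_apply, d_comp_d_hom,
    LinearMap.rTensor_zero, LinearMap.zero_apply]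

lemma TateData.extVan_of_lt (D : TateData P n) (hP : IsResolution P ε)
    (hproj : ∀ k, Projective (P.X k)) {i : ℕ} (hi : n < i) : ExtVan R i M R := by
  obtain ⟨i, rfl⟩ : ∃ j, i = j + 1 := ⟨i - 1, by omega⟩
  refine ((hP.toProjectiveResolution hproj).subsingleton_ext_succ_iff _ i).2 fun f hf => ?_
  let f' : P.X (i + 1) →ₗ[R] R := f.hom
  have hf' : f' ∘ₗ (P.d (i + 2) (i + 1)).hom = 0 := congrArg ModuleCat.Hom.hom hf
  obtain ⟨g, hg⟩ := D.dual_exact (Int.ofNat (i + 2)) (Int.ofNat (i + 1)) (Int.ofNat i)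
    (by simp; ring) (by simp) (f' ∘ₗ (D.θ (i + 1)).hom) (by
      rw [LinearMap.comp_assoc, ← D.comm_hom (i + 1), ← LinearMap.comp_assoc, hf',
        LinearMap.zero_comp])
  let e := LinearEquiv.ofBijective (D.θ i).hom (D.bij i (by omega))
  refine ⟨ModuleCat.ofHom (g ∘ₗ e.symm.toLinearMap), ?_⟩
  have : (g ∘ₗ e.symm.toLinearMap) ∘ₗ (P.d (i + 1) i).hom = f' := by
    refine LinearMap.ext fun y => ?_
    obtain ⟨y, rfl⟩ := (D.bij (i + 1) (by omega)).2 y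
    have h1 : (P.d (i + 1) i).hom ((D.θ (i + 1)).hom y) = e _ :=
      LinearMap.congr_fun (D.comm_hom i) y
    rw [LinearMap.comp_apply, h1, LinearMap.comp_apply, LinearEquiv.coe_coe, e.symm_apply_apply]
    exact LinearMap.congr_fun hg y
  ext1
  exact this

lemma TateData.smul_ext_eq_zero {m : ℕ} (D : TateData P (m + 1)) (hP : IsResolution P ε)
    (hproj : ∀ k, Projective (P.X k)) {s : R}
    (hs : ∀ c : Module.Dual R (D.T.X (Int.ofNat m)),
      ∃ (a : Module.Dual R (D.T.X (Int.ofNat m - 1))) (b : Module.Dual R (P.X m)),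
        a ∘ₗ (D.T.d (Int.ofNat m) (Int.ofNat m - 1)).hom + b ∘ₗ (D.θ m).hom = s • c)
    (e : Abelian.Ext.{u} (ModuleCat.of R M) (ModuleCat.of R R) (m + 1)) : s • e = 0 := by
  refine (hP.toProjectiveResolution hproj).smul_ext_succ_eq_zero (fun f hf => ?_) e
  let f' : P.X (m + 1) →ₗ[R] R := f.hom
  have hf' : f' ∘ₗ (P.d (m + 2) (m + 1)).hom = 0 := congrArg ModuleCat.Hom.hom hf
  obtain ⟨g, hg⟩ := D.dual_exact (Int.ofNat (m + 2)) (Int.ofNat (m + 1)) (Int.ofNat m)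
    (by simp; ring) (by simp) (f' ∘ₗ (D.θ (m + 1)).hom) (by
      rw [LinearMap.comp_assoc, ← D.comm_hom (m + 1), ← LinearMap.comp_assoc, hf',
        LinearMap.zero_comp])
  obtain ⟨a, b, hab⟩ := hs g
  refine ⟨ModuleCat.ofHom b, ?_⟩
  have : b ∘ₗ (P.d (m + 1) m).hom = s • f' := by
    refine LinearMap.ext fun y => ?_
    obtain ⟨y, rfl⟩ := (D.bij (m + 1) le_rfl).2 y
    have h1 := LinearMap.congr_fun (D.comm_hom m) y
    have h2 := LinearMap.congr_fun hab ((D.T.d (Int.ofNat (m + 1)) (Int.ofNat m)).hom y)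
    have h3 := LinearMap.congr_fun (d_comp_d_hom D.T (Int.ofNat (m + 1)) (Int.ofNat m)
      (Int.ofNat m - 1)) y
    have h4 := LinearMap.congr_fun hg y
    simp only [LinearMap.comp_apply, LinearMap.add_apply, LinearMap.smul_apply,
      LinearMap.zero_apply] at h1 h2 h3 h4 ⊢
    rw [h1, ← h4, ← h2, h3, map_zero, zero_add]
  ext1
  exact this

end MainInduction

end

section

open scoped Pointwise

section MainTheorem

variable [IsNoetherianRing R] {M : Type u} [AddCommGroup M] [Module R M] [Module.Finite R M]
  {P : ChainComplex (ModuleCat.{u} R) ℕ} {ε : P.X 0 ⟶ ModuleCat.of R M} {n : ℕ}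

/-- Below the top degree, `M` is annihilated by an `N`-regular element. -/
lemma TateData.exists_isSMulRegular_mem_annihilator {m : ℕ} (D : TateData P (m + 1))
    (hP : IsResolution P ε) (hPf : ∀ k, Module.Free R (P.X k))
    (hPfin : ∀ k, Module.Finite R (P.X k)) (hproj : ∀ k, Projective (P.X k))
    (hgrade : ∀ i < m + 1, ExtVan R i M R) {N : Type u} [AddCommGroup N] [Module R N]
    [Module.Finite R N] (h : TateVanFrom D.T N m) (hT : TorVan P N (m + 1)) :
    ∃ x ∈ Module.annihilator R M, IsSMulRegular N x := by
  have := D.free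
  have := D.finite
  obtain ⟨s, hs, hsd⟩ := exists_isSMulRegular_smul_dual (N := N)
    (D.T.d (Int.ofNat m) (Int.ofNat m - 1)).hom (D.θ m).hom
    (D.eq_zero_of_rTensor_eq_zero h hT)
  have hE : ExtPowTorsion s M R := fun i => by
    rcases lt_trichotomy i (m + 1) with hi | rfl | hi
    · exact ⟨0, fun e => Subsingleton.elim (h := hgrade i hi) _ _⟩
    · exact ⟨1, fun e => by rw [pow_one]; exact D.smul_ext_eq_zero hP hproj hsd e⟩
    · exact ⟨0, fun e => Subsingleton.elim (h := D.extVan_of_lt hP hproj hi) _ _⟩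
  obtain ⟨k, hk⟩ := exists_pow_smul_eq_zero_of_extPowTorsion hE
  exact ⟨s ^ k, Module.mem_annihilator.2 hk, hs.pow k⟩

/-- If `s` is the largest degree in which `Tor` is nonzero, then `n - s` is the smallest degree
in which `Ext` is nonzero. -/
theorem TateData.extVan_of_torVan (D : TateData P n)
    (hP : IsResolution P ε) (hPf : ∀ k, Module.Free R (P.X k))
    (hPfin : ∀ k, Module.Finite R (P.X k)) (hproj : ∀ k, Projective (P.X k))
    (hgrade : ∀ i < n, ExtVan R i M R) (d : ℕ) :
    ∀ (s : ℕ) (_ : s + d = n) (N : Type u) [AddCommGroup N] [Module R N] [Module.Finite R N]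
      (_ : ¬ TorVan P N s) (_ : ∀ i, s < i → TorVan P N i) (_ : TateVanFrom D.T N s),
      (∀ i < d, ExtVan R i M N) ∧ ¬ ExtVan R d M N := by
  induction d with
  | zero =>
    rintro s rfl N _ _ _ hs - hT
    refine ⟨fun i hi => absurd hi (by omega), fun h => hs ?_⟩
    obtain ⟨x, hx, hreg⟩ := IsSMulRegular.subsingleton_linearMap_iff.1 (extVan_zero_iff.1 h)
    exact D.torVan_top hP hproj hT hx hreg
  | succ d ih =>
    intro s hsd N _ _ _ hs hs' hT
    obtain ⟨m, rfl⟩ : ∃ m, n = m + 1 := ⟨s + d, by omega⟩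
    obtain ⟨x, hx, hreg⟩ := D.exists_isSMulRegular_mem_annihilator hP hPf hPfin hproj hgrade
      (N := N) (fun i j k hi hj hk => hT i j k hi hj (by omega)) (hs' _ (by omega))
    have hq := LinearMap.exact_lsmul_mkQ_smul_top N x
    have hqs := Submodule.mkQ_surjective (x • (⊤ : Submodule R N))
    have h0 : ExtVan R 0 M N := extVan_zero_iff.2
      (IsSMulRegular.linearMap_subsingleton_of_mem_annihilator hreg hx)
    have hflat : ∀ k, Module.Flat R (P.X k) := fun k => inferInstance
    obtain ⟨hlt, hne⟩ := ih (s + 1) (by omega) (QuotSMulTop x N)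
      (fun h => hs (h.descend_of_exact_smul hreg hq hqs (d_comp_d_hom P _ _ _)
        fun z hz => hP.exists_rTensor_eq_smul hproj hx s N hz))
      (fun i hi => by
        obtain ⟨i, rfl⟩ : ∃ j, i = j + 1 := ⟨i - 1, by omega⟩
        exact (hs' (i + 1) (by omega)).of_exact_smul hreg hq hqs (hs' i (by omega))
          (d_comp_d_hom P _ _ _))
      (fun i j k hi hj hk => by
        have := D.free (k - 1)
        exact (hT i j k hi hj (by push_cast at hk; omega)).of_exact_smul hreg hq hqs
          (hT j k (k - 1) hj (by ring) (by push_cast at hk; omega)) (d_comp_d_hom D.T _ _ _))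
    have hall : ∀ i < d + 1, ExtVan R i M N := by
      rintro (_ | i) hi
      · exact h0
      · exact extVan_succ_of_exact_smul hreg hx hq hqs (hlt i (by omega))
    exact ⟨hall, fun h => hne (extVan_of_exact_smul hreg hq hqs (hall d (by omega)) h)⟩

end MainTheorem

end

section

open TensorProduct

section Conclusion

variable {M : Type u} [AddCommGroup M] [Module R M]
  {P : ChainComplex (ModuleCat.{u} R) ℕ} {ε : P.X 0 ⟶ ModuleCat.of R M}
  {N : Type u} [AddCommGroup N] [Module R N]

lemma IsResolution.not_torVan_zero (hP : IsResolution P ε) [IsLocalRing R] [Module.Finite R M]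
    [Nontrivial M] [Module.Finite R N] [Nontrivial N] : ¬ TorVan P N 0 := by
  intro h
  have hd : (P.d 0 (0 - 1)).hom = 0 := by
    rw [P.shape 0 (0 - 1) (by simp), ModuleCat.hom_zero]
  have hsub : Subsingleton (M ⊗[R] N) := by
    refine subsingleton_of_forall_eq 0 fun y => ?_
    obtain ⟨z, rfl⟩ := LinearMap.rTensor_surjective N hP.surjective y
    obtain ⟨w, rfl⟩ := h z (by rw [hd, LinearMap.rTensor_zero, LinearMap.zero_apply])
    exact (rTensor_exact N hP.exact_zero hP.surjective).apply_apply_eq_zero w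
  exact not_subsingleton_iff_nontrivial.2 (nontrivial_tensorProduct_of_isLocalRing M N) hsub

lemma IsResolution.torVan_iff (hP : IsResolution P ε) (hPf : ∀ k, Module.Free R (P.X k))
    [IsLocalRing R] [Module.Finite R M] [Nontrivial M] [Module.Finite R N] [Nontrivial N] (i : ℕ) :
    TorVan P N i ↔ IsZero (TorMod R i (ModuleCat.of R M) (ModuleCat.of R N)) := by
  cases i with
  | zero => exact iff_of_false hP.not_torVan_zero (not_isZero_torMod_zero M N)
  | succ i =>
    rw [hP.isZero_torMod_succ_iff hPf]
    refine ⟨fun h z => ⟨h z, ?_⟩, fun h z hz => (h z).1 hz⟩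
    rintro ⟨w, rfl⟩
    rw [rTensor_apply_apply, d_comp_d_hom, LinearMap.rTensor_zero, LinearMap.zero_apply]

variable [IsNoetherianRing R] [Module.Finite R M] [Nontrivial M]

variable (M) in
lemma gradeM_ne_top : gradeM R (ModuleCat.of R M) ≠ ⊤ := by
  intro h
  have hE : ExtPowTorsion 1 M R := fun i => ⟨0, fun e => by
    have hi : IsZero (ExtMod R i (ModuleCat.of R M) (ModuleCat.of R R)) := by
      by_contra hi
      have := sInf_eq_top.1 h (i : ℕ∞) ⟨i, rfl, hi⟩
      exact ENat.natCast_ne_top i this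
    exact Subsingleton.elim (h := (isZero_extMod_iff _ _ i).1 hi) _ _⟩
  obtain ⟨k, hk⟩ := exists_pow_smul_eq_zero_of_extPowTorsion hE
  obtain ⟨m, hm⟩ := exists_ne (0 : M)
  exact hm (by simpa using hk m)

/-- The sum formula for `Tor` and `Ext` of a G-perfect module, in any universe. -/
theorem sSup_tor_add_sInf_ext [IsLocalRing R] [Module.Finite R N] [Nontrivial N]
    (hperf : IsGPerfect R (ModuleCat.of R M))
    (hvan : ∀ (C : CompleteResolution R (ModuleCat.of R M)) (i : ℤ),
      0 ≤ i → IsZero (TateTor R C (ModuleCat.of R N) i)) :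
    sSup {c : ℕ∞ | ∃ i : ℕ, c = i ∧
        ¬ IsZero (TorMod R i (ModuleCat.of R M) (ModuleCat.of R N))} +
      sInf {c : ℕ∞ | ∃ i : ℕ, c = i ∧
        ¬ IsZero (ExtMod R i (ModuleCat.of R M) (ModuleCat.of R N))} =
      gdim R (ModuleCat.of R M) := by
  have hne : {c : ℕ∞ | ∃ n : ℕ, c = n ∧ GDimLE R (ModuleCat.of R M) n}.Nonempty := by
    by_contra hempty
    refine gradeM_ne_top (R := R) M (hperf.trans ?_)
    rw [gdim, Set.not_nonempty_iff_eq_empty.1 hempty, sInf_empty]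
  obtain ⟨n, hn, hle⟩ : ∃ n : ℕ, gdim R (ModuleCat.of R M) = n ∧ GDimLE R (ModuleCat.of R M) n :=
    csInf_mem hne
  have hgrade : ∀ i < n, ExtVan R i M R := fun i hi => by
    rw [ExtVan, ← isZero_extMod_iff]
    by_contra hi'
    have h1 : gradeM R (ModuleCat.of R M) ≤ i := sInf_le ⟨i, rfl, hi'⟩
    rw [show gradeM R (ModuleCat.of R M) = n from hperf.trans hn] at h1
    exact absurd (Nat.cast_le.1 h1) (by omega)
  obtain ⟨P, ε, hP, hPf, hPfin⟩ := exists_finiteFree_resolution (ModuleCat.of R M)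
    (inferInstanceAs (Module.Finite R M))
  have hproj : ∀ k, Projective (P.X k) := fun k =>
    (IsProjective.iff_projective (R := R) (P.X k)).1
      (@Module.Projective.of_free R _ _ _ _ (hPf k))
  obtain ⟨D⟩ := hle.trDim.exists_tateData hP hPf hPfin
  have hTate : TateVanFrom D.T N 0 := fun i j k hi hj hk z hz =>
    (D.rTensor_exact_of_isZero (N := ModuleCat.of R N) hP hPf hPfin hi hj
      (hvan _ j (by simpa using hk)) z).1 hz
  have hbound : ∀ i, n < i → TorVan P N i := fun i hi => by
    obtain ⟨i, rfl⟩ : ∃ j, i = j + 1 := ⟨i - 1, by omega⟩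
    exact D.torVan_succ hTate (Nat.zero_le _) (by omega)
  classical
  let s := Nat.findGreatest (fun i => ¬ TorVan P N i) n
  have hs : ¬ TorVan P N s :=
    Nat.findGreatest_spec (P := fun i => ¬ TorVan P N i) (Nat.zero_le n) hP.not_torVan_zero
  have hsn : s ≤ n := Nat.findGreatest_le n
  have hs' : ∀ i, s < i → TorVan P N i := fun i hi => by
    by_cases hin : i ≤ n
    · exact not_not.1 (Nat.findGreatest_is_greatest hi hin)
    · exact hbound i (by omega)
  obtain ⟨hlt, hnot⟩ := D.extVan_of_torVan hP hPf hPfin hproj hgrade (n - s) s (by omega) N hs hs'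
    fun i j k hi hj hk => hTate i j k hi hj (by omega)
  have hsup : IsGreatest {c : ℕ∞ | ∃ i : ℕ, c = i ∧
      ¬ IsZero (TorMod R i (ModuleCat.of R M) (ModuleCat.of R N))} s := by
    refine ⟨⟨s, rfl, fun h => hs ((hP.torVan_iff hPf s).2 h)⟩, ?_⟩
    rintro _ ⟨i, rfl, hi⟩
    rw [Nat.cast_le]
    by_contra hc
    exact hi ((hP.torVan_iff hPf i).1 (hs' i (by omega)))
  have hinf : IsLeast {c : ℕ∞ | ∃ i : ℕ, c = i ∧
      ¬ IsZero (ExtMod R i (ModuleCat.of R M) (ModuleCat.of R N))} ((n - s : ℕ) : ℕ∞) := by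
    refine ⟨⟨n - s, rfl, fun h => hnot ((isZero_extMod_iff _ _ _).1 h)⟩, ?_⟩
    rintro _ ⟨i, rfl, hi⟩
    rw [Nat.cast_le]
    by_contra hc
    exact hi ((isZero_extMod_iff _ _ _).2 (hlt i (by omega)))
  rw [hsup.isLUB.sSup_eq, hinf.isGLB.sInf_eq, hn, ← Nat.cast_add, Nat.add_sub_cancel' hsn]

end Conclusion

end

end

/-- Let `M`, `N` be nonzero finitely generated modules over a (Noetherian) local ring `R`
with `M` G-perfect. If `T̂or_i^R(M,N) = 0` for all `i ≥ 0` (e.g. if `pd_R M < ∞` or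
`id_R N < ∞`), then
`sup{ i ≥ 0 | Tor_i^R(M,N) ≠ 0 } + inf{ i ≥ 0 | Ext^i_R(M,N) ≠ 0 } = G-dim_R M`. -/
theorem stmt_12 (R : Type) [CommRing R] [IsNoetherianRing R] [IsLocalRing R]
    (M N : Type) [AddCommGroup M] [Module R M] [Module.Finite R M] [Nontrivial M]
    [AddCommGroup N] [Module R N] [Module.Finite R N] [Nontrivial N]
    (hperf : IsGPerfect R (ModuleCat.of R M))
    (hvan : ∀ (C : CompleteResolution R (ModuleCat.of R M)) (i : ℤ),
      0 ≤ i → IsZero (TateTor R C (ModuleCat.of R N) i)) :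
    sSup {c : ℕ∞ | ∃ i : ℕ, c = i ∧
        ¬ IsZero (TorMod R i (ModuleCat.of R M) (ModuleCat.of R N))} +
      sInf {c : ℕ∞ | ∃ i : ℕ, c = i ∧
        ¬ IsZero (ExtMod R i (ModuleCat.of R M) (ModuleCat.of R N))} =
      gdim R (ModuleCat.of R M) := by
  exact sSup_tor_add_sInf_ext hperf hvan

end
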